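/- arXiv:math/0512574 — 3 statements merged into one kernel-verified Lean document; each statement's English description precedes it below -/
import Mathlib

section
/- Let L be a K-free color Lie algebra and ω a scalar graded 2-cocycle. Then the canonical map i_ω : L → U_ω(L) is an injective K-linear map, and for all homogeneous x,y ∈ L one has i_ω(x)i_ω(y) − ε(|x|,|y|)i_ω(y)i_ω(x) = i_ω([x,y]) + ω(x,y)·1. -/
open TensorAlgebra

/-- An antisymmetric bicharacter `ε : G × G → K` on an abelian group `G`. -/
structure ColorStructure (G K : Type*) [CommGroup G] [Field K] where
  ε : G → G → K
  antisym : ∀ g h, ε g h * ε h g = 1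
  mul_right : ∀ g h k, ε g (h * k) = ε g h * ε g k
  mul_left : ∀ g h k, ε (g * h) k = ε g k * ε h k

/-- A `G`-graded `ε`-Lie algebra (color Lie algebra) structure on a `K`-vector space `V`. -/
structure ColorLieAlgebra {G K : Type*} [CommGroup G] [DecidableEq G] [Field K]
    (χ : ColorStructure G K) (V : Type*) [AddCommGroup V] [Module K V] where
  grading : G → Submodule K V
  decomp : DirectSum.IsInternal grading
  bracket : V →ₗ[K] V →ₗ[K] V
  bracket_grade : ∀ g h : G, ∀ a ∈ grading g, ∀ b ∈ grading h,
    bracket a b ∈ grading (g * h)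
  bracket_antisym : ∀ g h : G, ∀ a ∈ grading g, ∀ b ∈ grading h,
    bracket a b = -(χ.ε g h • bracket b a)
  jacobi : ∀ g h k : G, ∀ a ∈ grading g, ∀ b ∈ grading h, ∀ c ∈ grading k,
    χ.ε k g • bracket a (bracket b c) + χ.ε g h • bracket b (bracket c a)
      + χ.ε h k • bracket c (bracket a b) = 0

/-- A scalar graded 2-cocycle of degree zero on a color Lie algebra,
with values in `K` regarded as a trivial graded `L`-module. -/
structure ColorCocycle {G K : Type*} [CommGroup G] [DecidableEq G] [Field K]
    {χ : ColorStructure G K} {V : Type*} [AddCommGroup V] [Module K V]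
    (L : ColorLieAlgebra χ V) where
  ω : V →ₗ[K] V →ₗ[K] K
  antisym : ∀ g h : G, ∀ a ∈ L.grading g, ∀ b ∈ L.grading h,
    ω a b = -(χ.ε g h * ω b a)
  cocycle : ∀ g h k : G, ∀ a ∈ L.grading g, ∀ b ∈ L.grading h, ∀ c ∈ L.grading k,
    χ.ε k g * ω a (L.bracket b c) + χ.ε g h * ω b (L.bracket c a)
      + χ.ε h k * ω c (L.bracket a b) = 0
  degree_zero : ∀ g h : G, g * h ≠ 1 → ∀ a ∈ L.grading g, ∀ b ∈ L.grading h, ω a b = 0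

variable {G K V : Type*} [CommGroup G] [DecidableEq G] [Field K] [AddCommGroup V] [Module K V]
  {χ : ColorStructure G K}

/-- The defining relations of the generalized enveloping algebra `U_ω(L)`. -/
inductive URel (L : ColorLieAlgebra χ V) (c : ColorCocycle L) :
    TensorAlgebra K V → TensorAlgebra K V → Prop
  | rel {g h : G} {a b : V} (ha : a ∈ L.grading g) (hb : b ∈ L.grading h) :
      URel L c (ι K a * ι K b)
        (χ.ε g h • (ι K b * ι K a) + ι K (L.bracket a b)
          + algebraMap K (TensorAlgebra K V) (c.ω a b))

/-- The generalized enveloping algebra `U_ω(L)`: the quotient of the tensor algebra `T(L)`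
by the two-sided ideal generated by the elements
`v₁ ⊗ v₂ - ε(|v₁|,|v₂|) v₂ ⊗ v₁ - [v₁,v₂] - ω(v₁,v₂)` for homogeneous `v₁, v₂`. -/
def Uenv (L : ColorLieAlgebra χ V) (c : ColorCocycle L) : Type _ :=
  RingQuot (URel L c)

noncomputable instance (L : ColorLieAlgebra χ V) (c : ColorCocycle L) : Ring (Uenv L c) :=
  inferInstanceAs (Ring (RingQuot (URel L c)))

noncomputable instance (L : ColorLieAlgebra χ V) (c : ColorCocycle L) :
    Algebra K (Uenv L c) :=
  inferInstanceAs (Algebra K (RingQuot (URel L c)))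

/-- The canonical map `i_ω : L → U_ω(L)`. -/
noncomputable def Uι (L : ColorLieAlgebra χ V) (c : ColorCocycle L) : V →ₗ[K] Uenv L c :=
  (RingQuot.mkAlgHom K (URel L c)).toLinearMap ∘ₗ ι K

/-- The canonical positive filtration on `U_ω(L)`: `Ufil L c n` is the span of products of
at most `n` images of elements of `L` (the image of `T_n(L)`). -/
noncomputable def Ufil (L : ColorLieAlgebra χ V) (c : ColorCocycle L) (n : ℕ) :
    Submodule K (Uenv L c) :=
  Submodule.span K {u | ∃ l : List V, l.length ≤ n ∧ u = (l.map (Uι L c)).prod}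

/-- `Ulow L c n` is `Ufil L c (n-1)`, with the convention `Ufil L c (-1) = ⊥`. -/
noncomputable def Ulow (L : ColorLieAlgebra χ V) (c : ColorCocycle L) :
    ℕ → Submodule K (Uenv L c)
  | 0 => ⊥
  | n + 1 => Ufil L c n

/-- The `G`-grading of `U_ω(L)`: the `g`-component is spanned by products of images of
homogeneous elements whose degrees multiply to `g`. -/
noncomputable def Ugrading (L : ColorLieAlgebra χ V) (c : ColorCocycle L) (g : G) :
    Submodule K (Uenv L c) :=
  Submodule.span K {u | ∃ l : List (G × V), (∀ p ∈ l, p.2 ∈ L.grading p.1) ∧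
    (l.map Prod.fst).prod = g ∧ u = (l.map fun p => Uι L c p.2).prod}

/-- Affine operators satisfying the Coxeter relations of type `A` have a common fixed point
in characteristic zero. -/
theorem exists_fixed_of_coxeter [CharZero K] {E : Type*} [AddCommGroup E] [Module K E]
    (A : ℕ → E →ₗ[K] E) (d : ℕ → E) (s : ℕ → E → E) (hs : ∀ k x, s k x = A k x + d k)
    (hinv : ∀ k x, s k (s k x) = x)
    (hcomm : ∀ k l x, k + 2 ≤ l → s k (s l x) = s l (s k x))
    (N : ℕ)
    (hbraid : ∀ k x, k + 1 < N →
      s k (s (k + 1) (s k x)) = s (k + 1) (s k (s (k + 1) x))) :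
    ∃ x, ∀ k < N, s k x = x := by
  induction N with
  | zero => exact ⟨0, by simp⟩
  | succ N ih =>
    obtain ⟨x, hx⟩ := ih fun k x hk => hbraid k x (by omega)
    let g : ℕ → E := fun i => Nat.rec x (fun i y => s (N - i) y) i
    have g_succ : ∀ i, g (i + 1) = s (N - i) (g i) := fun _ => rfl
    have fixed_low : ∀ i k, k + i < N → s k (g i) = g i := by
      intro i
      induction i with
      | zero => exact fun k hk => hx k (by omega)
      | succ i ih =>
        intro k hk
        rw [g_succ, hcomm _ _ _ (by omega), ih k (by omega)]
    have fixed_high : ∀ i k, i ≤ N + 1 → k ≤ N → N + 1 < k + i → s k (g i) = g i := by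
      intro i
      induction i with
      | zero => intro k _ _ hk; omega
      | succ i ih =>
        intro k hi hkN hk
        by_cases hk' : N + 1 < k + i
        · rw [g_succ, ← hcomm _ _ _ (by omega), ih k (by omega) hkN hk']
        · obtain ⟨i, rfl⟩ : ∃ m, i = m + 1 := ⟨i - 1, by omega⟩
          obtain ⟨k, rfl⟩ : ∃ m, k = m + 1 := ⟨k - 1, by omega⟩
          have h₁ : N - i = k + 1 := by omega
          have h₂ : N - (i + 1) = k := by omega
          rw [g_succ, g_succ, h₁, h₂, ← hbraid _ _ (by omega), fixed_low i k (by omega)]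
    have perm : ∀ k ≤ N, ∀ i ≤ N + 1,
        s k (g i) = g (Equiv.swap (N - k) (N - k + 1) i) := by
      intro k hk i hi
      rcases lt_trichotomy (k + i) N with h | h | h
      · rw [fixed_low i k h, Equiv.swap_apply_of_ne_of_ne (by omega) (by omega)]
      · obtain rfl : i = N - k := by omega
        rw [Equiv.swap_apply_left, g_succ]
        congr 1; omega
      · by_cases h' : k + i = N + 1
        · obtain rfl : i = N - k + 1 := by omega
          rw [Equiv.swap_apply_right, g_succ]
          have : N - (N - k) = k := by omega
          rw [this, hinv]
        · rw [fixed_high i k hi hk (by omega),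
            Equiv.swap_apply_of_ne_of_ne (by omega) (by omega)]
    have hN : ((N + 2 : ℕ) : K) ≠ 0 := by exact_mod_cast (by omega : N + 2 ≠ 0)
    refine ⟨((N + 2 : ℕ) : K)⁻¹ • ∑ i ∈ Finset.range (N + 2), g i, fun k hk => ?_⟩
    have hsum : ∑ i ∈ Finset.range (N + 2), s k (g i) = ∑ i ∈ Finset.range (N + 2), g i := by
      refine Finset.sum_equiv (Equiv.swap (N - k) (N - k + 1)) (fun i => ?_)
        (fun i hi => perm k (by omega) i (by have := Finset.mem_range.1 hi; omega))
      simp only [Finset.mem_range, Equiv.swap_apply_def]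
      split_ifs <;> omega
    have hd : d k = ((N + 2 : ℕ) : K)⁻¹ • ∑ _i ∈ Finset.range (N + 2), d k := by
      rw [Finset.sum_const, Finset.card_range, ← Nat.cast_smul_eq_nsmul K, inv_smul_smul₀ hN]
    rw [hs, map_smul, map_sum]
    conv_lhs => rw [hd]
    rw [← smul_add, ← Finset.sum_add_distrib]
    simp only [← hs, hsum]

/-- Twisted transposition of the letters in positions `k`, `k + 1` of a word of length `n`, acting
on functions of words, with an inhomogeneous term `C`. -/
def twistedSwap {B M : Type*} [AddCommGroup M] [Module K M] (e : B → B → K)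
    (C : List B → B → B → List B → M) (n k : ℕ) (f : List B → M) (w : List B) : M :=
  if w.length = n then
    match w.drop k with
    | a :: b :: v => e a b • f (w.take k ++ b :: a :: v) + C (w.take k) a b v
    | _ => f w
  else f w

theorem twistedSwap_append {B M : Type*} [AddCommGroup M] [Module K M] (e : B → B → K)
    (C : List B → B → B → List B → M) {n k : ℕ} (f : List B → M) {u : List B} (a b : B)
    (v : List B) (hu : u.length = k)
    (hn : u.length + v.length + 2 = n) :
    twistedSwap e C n k f (u ++ a :: b :: v) = e a b • f (u ++ b :: a :: v) + C u a b v := by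
  subst hu hn
  have : (u ++ a :: b :: v).length = u.length + v.length + 2 := by simp; omega
  simp [twistedSwap, this]

theorem twistedSwap_of_length_lt {B M : Type*} [AddCommGroup M] [Module K M] (e : B → B → K)
    (C : List B → B → B → List B → M) {n k : ℕ} (f : List B → M) {w : List B}
    (hw : w.length < k + 2) : twistedSwap e C n k f w = f w := by
  have h := List.length_drop (i := k) (l := w)
  unfold twistedSwap
  split
  · split
    · rename_i heq
      rw [heq] at h
      simp only [List.length_cons] at h
      omega
    · rfl
  · rfl

theorem twistedSwap_of_length_ne {B M : Type*} [AddCommGroup M] [Module K M] (e : B → B → K)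
    (C : List B → B → B → List B → M) {n k : ℕ} (f : List B → M) {w : List B}
    (hw : w.length ≠ n) : twistedSwap e C n k f w = f w :=
  if_neg hw

theorem List.exists_eq_append_cons_cons {B : Type*} {w : List B} {k : ℕ}
    (h : k + 2 ≤ w.length) :
    ∃ u a b v, w = u ++ a :: b :: v ∧ u.length = k := by
  refine ⟨w.take k, w[k], w[k + 1], w.drop (k + 2), ?_, by simp; omega⟩
  rw [← List.drop_eq_getElem_cons, ← List.drop_eq_getElem_cons, List.take_append_drop]

/-- The inhomogeneous twisted symmetry equations on words are solvable as soon as the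
inhomogeneous term satisfies the compatibilities coming from the Coxeter relations. -/
theorem exists_twistedSwap_solution [CharZero K] {B M : Type*} [AddCommGroup M] [Module K M]
    (e : B → B → K) (C : List B → B → B → List B → M)
    (he : ∀ a b, e a b * e b a = 1)
    (hanti : ∀ u a b v, C u a b v = -(e a b • C u b a v))
    (hcomm : ∀ u a b m p q v, C u a b (m ++ p :: q :: v) - e p q • C u a b (m ++ q :: p :: v)
      = C (u ++ a :: b :: m) p q v - e a b • C (u ++ b :: a :: m) p q v)
    (hbraid : ∀ u a b d v, C u a b (d :: v) + e a b • C (u ++ [b]) a d v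
        + (e a b * e a d) • C u b d (a :: v)
      = C (u ++ [a]) b d v + e b d • C u a d (b :: v)
        + (e b d * e a d) • C (u ++ [d]) a b v) (n : ℕ) :
    ∃ f : List B → M, ∀ u a b v, u.length + v.length + 2 = n →
      f (u ++ a :: b :: v) = e a b • f (u ++ b :: a :: v) + C u a b v := by
  let A : ℕ → (List B → M) →ₗ[K] (List B → M) := fun k =>
    { toFun := twistedSwap e (fun _ _ _ _ => 0) n k
      map_add' := by
        intro f g
        ext w
        simp only [twistedSwap, Pi.add_apply]
        split <;> [split; skip] <;> simp
      map_smul' := by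
        intro r f
        ext w
        simp only [twistedSwap, Pi.smul_apply, RingHom.id_apply]
        split <;> [split; skip] <;> simp [smul_comm r] }
  have hs : ∀ k f, twistedSwap e C n k f = A k f + twistedSwap e C n k 0 := by
    intro k f
    ext w
    simp only [A, LinearMap.coe_mk, AddHom.coe_mk, twistedSwap, Pi.add_apply]
    split <;> [split; skip] <;> simp
  have h_inv : ∀ k f, twistedSwap e C n k (twistedSwap e C n k f) = f := by
    intro k f
    ext w
    rcases ne_or_eq w.length n with hn | hn
    · simp only [twistedSwap_of_length_ne e C _ hn]
    rcases lt_or_ge w.length (k + 2) with h | h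
    · simp only [twistedSwap_of_length_lt e C _ h]
    · obtain ⟨u, a, b, v, rfl, rfl⟩ := List.exists_eq_append_cons_cons h
      have hn' : u.length + v.length + 2 = n := by simp at hn; omega
      rw [twistedSwap_append e C _ a b v rfl hn', twistedSwap_append e C _ b a v rfl hn', hanti u a b v,
        smul_add, smul_smul, he, one_smul]
      abel
  have h_comm : ∀ k l f, k + 2 ≤ l → twistedSwap e C n k (twistedSwap e C n l f)
      = twistedSwap e C n l (twistedSwap e C n k f) := by
    intro k l f hkl
    ext w
    rcases ne_or_eq w.length n with hn | hn
    · simp only [twistedSwap_of_length_ne e C _ hn]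
    rcases lt_or_ge w.length (l + 2) with h | h
    · rw [twistedSwap_of_length_lt e C _ h]
      rcases lt_or_ge w.length (k + 2) with h' | h'
      · simp only [twistedSwap_of_length_lt e C _ h, twistedSwap_of_length_lt e C _ h']
      · obtain ⟨u, a, b, v, rfl, rfl⟩ := List.exists_eq_append_cons_cons h'
        have hn' : u.length + v.length + 2 = n := by simp at hn; omega
        rw [twistedSwap_append e C _ a b v rfl hn', twistedSwap_append e C _ a b v rfl hn',
          twistedSwap_of_length_lt]
        simpa using h
    · obtain ⟨u', p, q, v, rfl, rfl⟩ := List.exists_eq_append_cons_cons h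
      obtain ⟨u, a, b, m, rfl, rfl⟩ := List.exists_eq_append_cons_cons hkl
      have hn₁ : (u ++ a :: b :: m).length + v.length + 2 = n := by simp at hn ⊢; omega
      have hn₂ : (u ++ b :: a :: m).length + v.length + 2 = n := by simp at hn ⊢; omega
      have hn₃ : ∀ x y, u.length + (m ++ x :: y :: v).length + 2 = n := by
        intro x y; simp at hn ⊢; omega
      rw [twistedSwap_append e C _ p q v rfl hn₁]
      have assoc : ∀ (x y z t : B),
          (u ++ x :: y :: m) ++ z :: t :: v = u ++ x :: y :: (m ++ z :: t :: v) := by simp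
      have len : (u ++ a :: b :: m).length = (u ++ b :: a :: m).length := by simp
      rw [assoc, twistedSwap_append e C _ a b _ rfl (hn₃ _ _), assoc, twistedSwap_append e C _ a b _ rfl (hn₃ _ _),
        ← assoc b a p q, twistedSwap_append e C f p q v len.symm hn₂, assoc]
      have h := hcomm u a b m p q v
      rw [sub_eq_sub_iff_add_eq_add] at h
      simp only [smul_add, smul_smul, mul_comm (e p q) (e a b)]
      rw [add_assoc, add_assoc, add_comm (e a b • _) (C u a b _), h]
      rw [add_comm (C _ _ _ _) (e p q • _)]
  have h_braid : ∀ k f, k + 1 < n - 1 →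
      twistedSwap e C n k (twistedSwap e C n (k + 1) (twistedSwap e C n k f))
      = twistedSwap e C n (k + 1) (twistedSwap e C n k (twistedSwap e C n (k + 1) f)) := by
    intro k f hk
    ext w
    rcases ne_or_eq w.length n with hn | hn
    · simp only [twistedSwap_of_length_ne e C _ hn]
    obtain ⟨u, a, b, v', rfl, rfl⟩ := List.exists_eq_append_cons_cons (by omega : k + 2 ≤ w.length)
    obtain ⟨d, v, rfl⟩ : ∃ d v, v' = d :: v := by
      cases v' with
      | nil => simp at hn hk; omega
      | cons d v => exact ⟨d, v, rfl⟩
    have h₀ : ∀ g x y z, twistedSwap e C n u.length g (u ++ x :: y :: z :: v)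
        = e x y • g (u ++ y :: x :: z :: v) + C u x y (z :: v) :=
      fun g x y z => twistedSwap_append e C g x y _ rfl (by simp at hn ⊢; omega)
    have h₁ : ∀ g x y z, twistedSwap e C n (u.length + 1) g (u ++ x :: y :: z :: v)
        = e y z • g (u ++ x :: z :: y :: v) + C (u ++ [x]) y z v := by
      intro g x y z
      have := twistedSwap_append e C (n := n) (k := u.length + 1) g (u := u ++ [x]) y z v (by simp)
        (by simp at hn ⊢; omega)
      simpa using this
    simp only [h₀, h₁]
    have h := hbraid u a b d v
    simp only [smul_add, smul_smul]
    rw [show e b d * (e a d * e a b) = e a b * (e a d * e b d) by ring]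
    rw [add_assoc, add_assoc, add_assoc, add_assoc]
    congr 1
    rw [mul_comm (e b d) (e a d)] at h
    calc _ = C u a b (d :: v) + e a b • C (u ++ [b]) a d v
          + (e a b * e a d) • C u b d (a :: v) := by abel
      _ = _ := by rw [h, mul_comm (e b d) (e a d)]; abel
  obtain ⟨f, hf⟩ := exists_fixed_of_coxeter A (fun k => twistedSwap e C n k 0)
    (twistedSwap e C n) hs h_inv h_comm (n - 1) h_braid
  refine ⟨f, fun u a b v h => ?_⟩
  conv_lhs => rw [← hf u.length (by omega)]
  exact twistedSwap_append e C f a b v rfl h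
/-- The product in the tensor algebra of the vectors indexed by a word. -/
noncomputable def wordProd {B : Type*} (b : B → V) (w : List B) : TensorAlgebra K V :=
  (w.map fun i => ι K (b i)).prod

theorem wordProd_append {B : Type*} (b : B → V) (u v : List B) :
    wordProd (K := K) b (u ++ v) = wordProd b u * wordProd b v := by
  simp [wordProd]

theorem wordProd_cons {B : Type*} (b : B → V) (i : B) (v : List B) :
    wordProd (K := K) b (i :: v) = ι K (b i) * wordProd b v := by
  simp [wordProd]

theorem wordProd_nil {B : Type*} (b : B → V) : wordProd (K := K) b [] = 1 := rfl

theorem Module.Basis.tensorAlgebra_ofList {B : Type*} (b : Module.Basis B K V) (w : List B) :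
    b.tensorAlgebra (FreeMonoid.ofList w) = wordProd b w := by
  have key : (TensorAlgebra.equivFreeAlgebra b).symm (FreeAlgebra.basisFreeMonoid K B
      (FreeMonoid.ofList w)) = wordProd b w := by
    induction w with
    | nil =>
      simp only [FreeAlgebra.basisFreeMonoid, FreeMonoid.ofList_nil, wordProd_nil]
      exact (congrArg _ (map_one FreeAlgebra.equivMonoidAlgebraFreeMonoid.symm)).trans (map_one _)
    | cons i w ih =>
      rw [wordProd_cons, ← ih, ← TensorAlgebra.equivFreeAlgebra_symm_ι, ← map_mul]
      congr 1
      have : (MonoidAlgebra.single (FreeMonoid.of i * FreeMonoid.ofList w) 1 :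
          MonoidAlgebra K (FreeMonoid B)) = MonoidAlgebra.of K _ (FreeMonoid.of i)
            * MonoidAlgebra.single (FreeMonoid.ofList w) 1 := by
        simp [MonoidAlgebra.single_mul_single]
      simp only [FreeAlgebra.basisFreeMonoid, FreeMonoid.ofList_cons]
      refine (congrArg FreeAlgebra.equivMonoidAlgebraFreeMonoid.symm this).trans ?_
      rw [map_mul]
      congr 1
      simp [FreeAlgebra.equivMonoidAlgebraFreeMonoid]
  simpa [Module.Basis.tensorAlgebra] using key

/-- A linear map on the tensor algebra with prescribed values on words in a basis. -/
theorem exists_linearMap_wordProd {B M : Type*} [AddCommGroup M] [Module K M]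
    (b : Module.Basis B K V) (f : List B → M) :
    ∃ Φ : TensorAlgebra K V →ₗ[K] M, ∀ w, Φ (wordProd b w) = f w := by
  refine ⟨b.tensorAlgebra.constr K fun w => f w.toList, fun w => ?_⟩
  rw [← b.tensorAlgebra_ofList, Module.Basis.constr_basis]
  rfl

/-- The span of the words of length at most `n`. -/
noncomputable def wordFil {B : Type*} (b : B → V) (n : ℕ) : Submodule K (TensorAlgebra K V) :=
  Submodule.span K (wordProd b '' {w | w.length ≤ n})

theorem wordProd_mem_wordFil {B : Type*} (b : B → V) {w : List B} {n : ℕ} (h : w.length ≤ n) :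
    wordProd b w ∈ wordFil (K := K) b n :=
  Submodule.subset_span ⟨w, h, rfl⟩

theorem wordFil_mono {B : Type*} (b : B → V) {m n : ℕ} (h : m ≤ n) :
    wordFil (K := K) b m ≤ wordFil b n :=
  Submodule.span_mono (Set.image_mono fun _ hw => le_trans hw h)

theorem mul_mem_wordFil {B : Type*} (b : B → V) {m n : ℕ} {s t : TensorAlgebra K V}
    (hs : s ∈ wordFil b m) (ht : t ∈ wordFil b n) : s * t ∈ wordFil b (m + n) := by
  have h : wordFil (K := K) b m * wordFil b n ≤ wordFil b (m + n) := by
    rw [wordFil, wordFil, Submodule.span_mul_span, Submodule.span_le]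
    rintro _ ⟨_, ⟨u, hu, rfl⟩, _, ⟨v, hv, rfl⟩, rfl⟩
    simp only [← wordProd_append]
    refine wordProd_mem_wordFil b ?_
    simp only [Set.mem_ofPred_eq, List.length_append] at *
    omega
  exact h (Submodule.mul_mem_mul hs ht)

theorem algebraMap_mem_wordFil {B : Type*} (b : B → V) (r : K) (n : ℕ) :
    algebraMap K (TensorAlgebra K V) r ∈ wordFil b n := by
  rw [Algebra.algebraMap_eq_smul_one]
  exact Submodule.smul_mem _ _ (wordProd_mem_wordFil b (w := []) (by simp))

theorem ι_mem_wordFil {B : Type*} (b : Module.Basis B K V) (x : V) :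
    ι K x ∈ wordFil (K := K) b 1 := by
  induction b.mem_span x using Submodule.span_induction with
  | zero => simp
  | mem x hx =>
    obtain ⟨i, rfl⟩ := hx
    simpa [wordProd] using wordProd_mem_wordFil (K := K) b (w := [i]) (n := 1) (by simp)
  | add x y _ _ hx hy => rw [map_add]; exact add_mem hx hy
  | smul r x _ hx => rw [map_smul]; exact Submodule.smul_mem _ _ hx

theorem exists_mem_wordFil {B : Type*} (b : Module.Basis B K V) (t : TensorAlgebra K V) :
    ∃ n, t ∈ wordFil (K := K) b n := by
  induction b.tensorAlgebra.mem_span t using Submodule.span_induction with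
  | zero => exact ⟨0, zero_mem _⟩
  | mem x hx =>
    obtain ⟨w, rfl⟩ := hx
    refine ⟨w.toList.length, ?_⟩
    rw [show w = FreeMonoid.ofList w.toList from rfl, b.tensorAlgebra_ofList]
    exact wordProd_mem_wordFil b le_rfl
  | add x y _ _ hx hy =>
    obtain ⟨m, hm⟩ := hx
    obtain ⟨n, hn⟩ := hy
    exact ⟨max m n, add_mem (wordFil_mono b (le_max_left _ _) hm)
      (wordFil_mono b (le_max_right _ _) hn)⟩
  | smul r x _ hx =>
    obtain ⟨m, hm⟩ := hx
    exact ⟨m, Submodule.smul_mem _ _ hm⟩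

theorem eqOn_wordFil {B M : Type*} [AddCommGroup M] [Module K M] (b : B → V)
    {Φ Ψ : TensorAlgebra K V →ₗ[K] M} {n : ℕ}
    (h : ∀ w : List B, w.length ≤ n → Φ (wordProd b w) = Ψ (wordProd b w))
    {t : TensorAlgebra K V} (ht : t ∈ wordFil b n) : Φ t = Ψ t := by
  refine LinearMap.eqOn_span (f := Φ) (g := Ψ) ?_ ht
  rintro _ ⟨w, hw, rfl⟩
  exact h w hw

/-- The lower order part `[x, y] + ω(x, y)` of the defining relations of `U_ω(L)`. -/
noncomputable def lowerTerm (L : ColorLieAlgebra χ V) (c : ColorCocycle L) :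
    V →ₗ[K] V →ₗ[K] TensorAlgebra K V :=
  L.bracket.compr₂ (ι K) + c.ω.compr₂ (Algebra.linearMap K (TensorAlgebra K V))

theorem lowerTerm_apply (L : ColorLieAlgebra χ V) (c : ColorCocycle L) (x y : V) :
    lowerTerm L c x y
      = ι K (L.bracket x y) + algebraMap K (TensorAlgebra K V) (c.ω x y) := rfl

theorem lowerTerm_mem_wordFil {B : Type*} (L : ColorLieAlgebra χ V) (c : ColorCocycle L)
    (b : Module.Basis B K V) (x y : V) : lowerTerm L c x y ∈ wordFil (K := K) b 1 :=
  add_mem (ι_mem_wordFil b _) (algebraMap_mem_wordFil b _ _)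

theorem lowerTerm_antisymm (L : ColorLieAlgebra χ V) (c : ColorCocycle L) {g h : G} {x y : V}
    (hx : x ∈ L.grading g) (hy : y ∈ L.grading h) :
    lowerTerm L c x y = -(χ.ε g h • lowerTerm L c y x) := by
  rw [lowerTerm_apply, lowerTerm_apply, L.bracket_antisym g h x hx y hy,
    c.antisym g h x hx y hy]
  simp only [map_neg, map_smul, map_mul, Algebra.smul_def, mul_add, neg_add]

/-- The defining relation `x y - e y x - [x, y] - ω(x, y)` of `U_ω(L)`, as a bilinear map. -/
noncomputable def colorRel (L : ColorLieAlgebra χ V) (c : ColorCocycle L) (e : K) :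
    V →ₗ[K] V →ₗ[K] TensorAlgebra K V :=
  (LinearMap.mul K (TensorAlgebra K V)).compl₁₂ (ι K) (ι K)
    - e • ((LinearMap.mul K (TensorAlgebra K V)).compl₁₂ (ι K) (ι K)).flip - lowerTerm L c

theorem colorRel_apply (L : ColorLieAlgebra χ V) (c : ColorCocycle L) (e : K) (x y : V) :
    colorRel L c e x y = ι K x * ι K y - e • (ι K y * ι K x) - lowerTerm L c x y := rfl

theorem colorRel_mem_wordFil {B : Type*} (L : ColorLieAlgebra χ V) (c : ColorCocycle L)
    (b : Module.Basis B K V) (e : K) (x y : V) : colorRel L c e x y ∈ wordFil (K := K) b 2 := by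
  have hmul : ∀ x y, ι K x * ι K y ∈ wordFil (K := K) b 2 := fun x y =>
    mul_mem_wordFil b (m := 1) (n := 1) (ι_mem_wordFil b x) (ι_mem_wordFil b y)
  have hlow : lowerTerm L c x y ∈ wordFil (K := K) b 2 :=
    wordFil_mono b (by omega) (lowerTerm_mem_wordFil L c b x y)
  rw [colorRel_apply]
  exact sub_mem (sub_mem (hmul x y) (Submodule.smul_mem _ _ (hmul y x))) hlow

/-- `Φ` vanishes on the multiples of the defining relations by words, up to total length `n`. -/
def KillsRel {B M : Type*} [AddCommGroup M] [Module K M] (L : ColorLieAlgebra χ V)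
    (c : ColorCocycle L) (b : B → V) (deg : B → G) (n : ℕ)
    (Φ : TensorAlgebra K V →ₗ[K] M) : Prop :=
  ∀ (u v : List B) (i j : B), u.length + v.length + 2 ≤ n →
    Φ (wordProd b u * colorRel L c (χ.ε (deg i) (deg j)) (b i) (b j) * wordProd b v) = 0

theorem KillsRel.apply_eq_zero {B M : Type*} [AddCommGroup M] [Module K M]
    {L : ColorLieAlgebra χ V} {c : ColorCocycle L} {b : B → V} {deg : B → G} {n : ℕ}
    {Φ : TensorAlgebra K V →ₗ[K] M} (hΦ : KillsRel L c b deg n Φ)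
    (hspan : ∀ g, L.grading g ≤ Submodule.span K (b '' {i | deg i = g}))
    {p q : ℕ} (hpq : p + q + 2 ≤ n) {s t : TensorAlgebra K V}
    (hs : s ∈ wordFil b p) (ht : t ∈ wordFil b q) {g h : G} {x y : V}
    (hx : x ∈ L.grading g) (hy : y ∈ L.grading h) :
    Φ (s * colorRel L c (χ.ε g h) x y * t) = 0 := by
  induction hs using Submodule.span_induction with
  | zero => simp
  | add s s' _ _ h h' => simp [add_mul, h, h']
  | smul r s _ h => simp [h]
  | mem s hs =>
  obtain ⟨u, hu, rfl⟩ := hs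
  induction ht using Submodule.span_induction with
  | zero => simp
  | add s s' _ _ h h' => simp [mul_add, h, h']
  | smul r s _ h => simp [h]
  | mem t ht =>
  obtain ⟨v, hv, rfl⟩ := ht
  replace hx := hspan g hx
  induction hx using Submodule.span_induction with
  | zero => simp
  | add s s' _ _ h h' => simp [mul_add, add_mul, h, h']
  | smul r s _ h => simp [h]
  | mem x hx =>
  obtain ⟨i, rfl, rfl⟩ := hx
  replace hy := hspan h hy
  induction hy using Submodule.span_induction with
  | zero => simp
  | add s s' _ _ h h' => simp [mul_add, add_mul, h, h']
  | smul r s _ h => simp [h]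
  | mem y hy =>
  obtain ⟨j, rfl, rfl⟩ := hy
  simp only [Set.mem_ofPred_eq] at hu hv
  exact hΦ u v i j (by omega)

theorem ColorStructure.ε_one_right (χ : ColorStructure G K) (g : G) : χ.ε g 1 = 1 := by
  have h := χ.mul_right g 1 1
  rw [mul_one] at h
  exact mul_left_cancel₀ (left_ne_zero_of_mul_eq_one (χ.antisym g 1)) (by rw [← h, mul_one])

theorem ColorCocycle.mul_eq_of_degree {L : ColorLieAlgebra χ V} (c : ColorCocycle L) {g h : G}
    {x y : V} (hx : x ∈ L.grading g) (hy : y ∈ L.grading h) (k : G) :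
    χ.ε k g * χ.ε k h * c.ω x y = c.ω x y := by
  by_cases hgh : g * h = 1
  · rw [← χ.mul_right, hgh, χ.ε_one_right, one_mul]
  · rw [c.degree_zero g h hgh x hx y hy, mul_zero]

/-- The Jacobi identity in Leibniz form, including the cocycle. -/
theorem lowerTerm_leibniz (L : ColorLieAlgebra χ V) (c : ColorCocycle L) {g h k : G} {x y z : V}
    (hx : x ∈ L.grading g) (hy : y ∈ L.grading h) (hz : z ∈ L.grading k) :
    lowerTerm L c x (L.bracket y z) = lowerTerm L c (L.bracket x y) z
      + χ.ε g h • lowerTerm L c y (L.bracket x z) := by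
  have hgk := χ.antisym g k
  have hkh := χ.antisym k h
  have hxy := L.bracket_grade g h x hx y hy
  have hz' : L.bracket z x = -(χ.ε k g • L.bracket x z) := L.bracket_antisym k g z hz x hx
  have hJ := L.jacobi g h k x hx y hy z hz
  have hJω := c.cocycle g h k x hx y hy z hz
  rw [L.bracket_antisym k (g * h) z hz _ hxy, hz', χ.mul_right] at hJ
  rw [c.antisym k (g * h) z hz _ hxy, hz', χ.mul_right] at hJω
  have h₁ : L.bracket x (L.bracket y z) = L.bracket (L.bracket x y) z
      + χ.ε g h • L.bracket y (L.bracket x z) := by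
    have := congrArg (χ.ε g k • ·) hJ
    simp only [map_neg, map_smul, smul_add, smul_neg, smul_smul, smul_zero] at this
    rw [hgk, one_smul, show χ.ε g k * (χ.ε g h * χ.ε k g) = χ.ε g h by
      linear_combination χ.ε g h * hgk,
      show χ.ε g k * (χ.ε h k * (χ.ε k g * χ.ε k h)) = 1 by
      linear_combination χ.ε h k * χ.ε k h * hgk + hkh, one_smul] at this
    rw [← sub_eq_zero, ← this]
    abel
  have h₂ : c.ω x (L.bracket y z) = c.ω (L.bracket x y) z
      + χ.ε g h • c.ω y (L.bracket x z) := by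
    simp only [map_neg, map_smul, smul_eq_mul] at hJω ⊢
    linear_combination χ.ε g k * hJω - (c.ω x (L.bracket y z)) * hgk
      + χ.ε g h * c.ω y (L.bracket x z) * hgk
      + c.ω (L.bracket x y) z * (χ.ε h k * χ.ε k h * hgk + hkh)
  simp only [lowerTerm_apply, h₁, h₂, map_add, map_smul, smul_eq_mul, map_mul, Algebra.smul_def]
  rw [mul_add]
  abel

theorem braid_defect_eq (L : ColorLieAlgebra χ V) (c : ColorCocycle L) {g h k : G} {x y z : V}
    (hx : x ∈ L.grading g) (hy : y ∈ L.grading h) (hz : z ∈ L.grading k) :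
    lowerTerm L c x y * ι K z + χ.ε g h • (ι K y * lowerTerm L c x z)
        + (χ.ε g h * χ.ε g k) • (lowerTerm L c y z * ι K x)
      - (ι K x * lowerTerm L c y z + χ.ε h k • (lowerTerm L c x z * ι K y)
        + (χ.ε h k * χ.ε g k) • (ι K z * lowerTerm L c x y))
      = colorRel L c (χ.ε (g * h) k) (L.bracket x y) z
        + χ.ε g h • colorRel L c (χ.ε h (g * k)) y (L.bracket x z)
        - colorRel L c (χ.ε g (h * k)) x (L.bracket y z) := by
  have hxy := c.mul_eq_of_degree hx hy k
  have hxz := c.mul_eq_of_degree hx hz h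
  have hyz := c.mul_eq_of_degree hy hz g
  have hxy' : c.ω x y = χ.ε h k * χ.ε g k * c.ω x y := by
    linear_combination (χ.ε h k * χ.ε g k) * hxy - c.ω x y * χ.ε h k * χ.ε k h * χ.antisym g k
      - c.ω x y * χ.antisym h k
  have hxz' : χ.ε g h * c.ω x z = χ.ε h k * c.ω x z := by
    linear_combination (-χ.ε g h) * hxz + χ.ε h k * c.ω x z * χ.antisym g h
  have e₁ : χ.ε g h * (χ.ε h g * χ.ε h k) = χ.ε h k := by
    linear_combination χ.ε h k * χ.antisym g h
  simp only [colorRel_apply, lowerTerm_leibniz L c hx hy hz, χ.mul_left, χ.mul_right, smul_sub,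
    smul_smul, e₁]
  simp only [lowerTerm_apply, add_mul, mul_add, smul_add, Algebra.algebraMap_eq_smul_one,
    smul_mul_assoc, mul_smul_comm, one_mul, mul_one, smul_smul, hxz', hyz]
  rw [← hxy', mul_comm (χ.ε h k) (χ.ε g k)]
  abel

/-- Extension of a map killing the relations of length at most `n` to length `n + 1`. -/
theorem KillsRel.exists_succ [CharZero K] {B M : Type*} [AddCommGroup M] [Module K M]
    {L : ColorLieAlgebra χ V} {c : ColorCocycle L} {b : Module.Basis B K V} {deg : B → G}
    (hdeg : ∀ i, b i ∈ L.grading (deg i))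
    (hspan : ∀ g, L.grading g ≤ Submodule.span K (b '' {i | deg i = g})) {n : ℕ}
    {Φ : TensorAlgebra K V →ₗ[K] M} (hΦ : KillsRel L c b deg n Φ) :
    ∃ Ψ : TensorAlgebra K V →ₗ[K] M, KillsRel L c b deg (n + 1) Ψ ∧
      ∀ w : List B, w.length ≤ n → Ψ (wordProd b w) = Φ (wordProd b w) := by
  let e : B → B → K := fun i j => χ.ε (deg i) (deg j)
  let C : List B → B → B → List B → M := fun u i j v =>
    if u.length + v.length + 1 = n then
      Φ (wordProd b u * lowerTerm L c (b i) (b j) * wordProd b v) else 0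
  have C_of_eq : ∀ u i j v, u.length + v.length + 1 = n →
      C u i j v = Φ (wordProd b u * lowerTerm L c (b i) (b j) * wordProd b v) :=
    fun u i j v h => if_pos h
  have C_of_ne : ∀ u i j v, u.length + v.length + 1 ≠ n → C u i j v = 0 :=
    fun u i j v h => if_neg h
  have hanti : ∀ u i j v, C u i j v = -(e i j • C u j i v) := by
    intro u i j v
    by_cases h : u.length + v.length + 1 = n
    · rw [C_of_eq _ _ _ _ h, C_of_eq _ _ _ _ h, lowerTerm_antisymm L c (hdeg i) (hdeg j)]
      simp [e]
    · rw [C_of_ne _ _ _ _ h, C_of_ne _ _ _ _ h]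
      simp
  have hcomm : ∀ u i j m p q v,
      C u i j (m ++ p :: q :: v) - e p q • C u i j (m ++ q :: p :: v)
        = C (u ++ i :: j :: m) p q v - e i j • C (u ++ j :: i :: m) p q v := by
    intro u i j m p q v
    by_cases h : u.length + m.length + v.length + 3 = n
    · have h₁ : ∀ x y, u.length + (m ++ x :: y :: v).length + 1 = n := by
        intro x y; simp; omega
      have h₂ : ∀ x y, (u ++ x :: y :: m).length + v.length + 1 = n := by
        intro x y; simp; omega
      simp only [C_of_eq _ _ _ _ (h₁ _ _), C_of_eq _ _ _ _ (h₂ _ _)]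
      have hl := lowerTerm_mem_wordFil L c b (b i) (b j)
      have hr := lowerTerm_mem_wordFil L c b (b p) (b q)
      have hw := fun w : List B => wordProd_mem_wordFil (K := K) b (le_refl w.length)
      have left := hΦ.apply_eq_zero hspan (p := u.length + 1 + m.length) (q := v.length)
        (by omega) (mul_mem_wordFil b (mul_mem_wordFil b (hw u) hl) (hw m)) (hw v)
        (hdeg p) (hdeg q)
      have right := hΦ.apply_eq_zero hspan (p := u.length) (q := m.length + 1 + v.length)
        (by omega) (hw u) (mul_mem_wordFil b (mul_mem_wordFil b (hw m) hr) (hw v))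
        (hdeg i) (hdeg j)
      rw [← sub_eq_zero, ← sub_eq_zero.2 (left.trans right.symm)]
      simp only [e, ← map_smul, ← map_sub]
      congr 1
      simp only [colorRel_apply, wordProd_append, wordProd_cons, mul_sub, sub_mul,
        smul_mul_assoc, mul_smul_comm, mul_assoc]
      abel
    · have h₁ : ∀ x y, u.length + (m ++ x :: y :: v).length + 1 ≠ n := by
        intro x y; simp; omega
      have h₂ : ∀ x y, (u ++ x :: y :: m).length + v.length + 1 ≠ n := by
        intro x y; simp; omega
      simp only [C_of_ne _ _ _ _ (h₁ _ _), C_of_ne _ _ _ _ (h₂ _ _)]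
      simp
  have hbraid : ∀ u i j k v, C u i j (k :: v) + e i j • C (u ++ [j]) i k v
        + (e i j * e i k) • C u j k (i :: v)
      = C (u ++ [i]) j k v + e j k • C u i k (j :: v)
        + (e j k * e i k) • C (u ++ [k]) i j v := by
    intro u i j k v
    by_cases h : u.length + v.length + 2 = n
    · have h₁ : ∀ x, u.length + (x :: v).length + 1 = n := by
        intro x; simp; omega
      have h₂ : ∀ x, (u ++ [x]).length + v.length + 1 = n := by
        intro x; simp; omega
      simp only [C_of_eq _ _ _ _ (h₁ _), C_of_eq _ _ _ _ (h₂ _)]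
      have hw := fun w : List B => wordProd_mem_wordFil (K := K) b (le_refl w.length)
      have key := congrArg (fun t => Φ (wordProd b u * t * wordProd b v))
        (braid_defect_eq L c (hdeg i) (hdeg j) (hdeg k))
      have r₁ := hΦ.apply_eq_zero hspan h.le (hw u) (hw v)
        (L.bracket_grade _ _ _ (hdeg i) _ (hdeg j)) (hdeg k)
      have r₂ := hΦ.apply_eq_zero hspan h.le (hw u) (hw v)
        (hdeg j) (L.bracket_grade _ _ _ (hdeg i) _ (hdeg k))
      have r₃ := hΦ.apply_eq_zero hspan h.le (hw u) (hw v)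
        (hdeg i) (L.bracket_grade _ _ _ (hdeg j) _ (hdeg k))
      simp only [mul_add, mul_sub, add_mul, sub_mul, map_add, map_sub, mul_smul_comm,
        smul_mul_assoc, map_smul, r₁, r₂, r₃, smul_zero, add_zero, sub_zero] at key
      rw [← sub_eq_zero, ← key]
      simp only [e, wordProd_append, wordProd_cons, wordProd_nil, mul_one, mul_assoc]
    · have h₁ : ∀ x, u.length + (x :: v).length + 1 ≠ n := by
        intro x; simp; omega
      have h₂ : ∀ x, (u ++ [x]).length + v.length + 1 ≠ n := by
        intro x; simp; omega
      simp only [C_of_ne _ _ _ _ (h₁ _), C_of_ne _ _ _ _ (h₂ _)]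
      simp
  obtain ⟨f, hf⟩ := exists_twistedSwap_solution e C (fun i j => χ.antisym _ _) hanti hcomm hbraid
    (n + 1)
  obtain ⟨Ψ, hΨ⟩ := exists_linearMap_wordProd b
    fun w => if w.length = n + 1 then f w else Φ (wordProd b w)
  have agree : ∀ w : List B, w.length ≤ n → Ψ (wordProd b w) = Φ (wordProd b w) := by
    intro w hw
    rw [hΨ, if_neg (by omega)]
  refine ⟨Ψ, fun u v i j h => ?_, agree⟩
  have hw := fun w : List B => wordProd_mem_wordFil (K := K) b (le_refl w.length)
  have hlow : Ψ (wordProd b u * lowerTerm L c (b i) (b j) * wordProd b v)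
      = Φ (wordProd b u * lowerTerm L c (b i) (b j) * wordProd b v) :=
    eqOn_wordFil b agree (wordFil_mono b (by omega) (mul_mem_wordFil b
      (mul_mem_wordFil b (hw u) (lowerTerm_mem_wordFil L c b _ _)) (hw v)))
  have expand : ∀ Θ : TensorAlgebra K V →ₗ[K] M,
      Θ (wordProd b u * colorRel L c (χ.ε (deg i) (deg j)) (b i) (b j) * wordProd b v)
        = Θ (wordProd b (u ++ i :: j :: v)) - e i j • Θ (wordProd b (u ++ j :: i :: v))
          - Θ (wordProd b u * lowerTerm L c (b i) (b j) * wordProd b v) := by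
    intro Θ
    rw [← map_smul, ← map_sub, ← map_sub]
    congr 1
    simp only [e, colorRel_apply, wordProd_append, wordProd_cons, mul_sub, sub_mul,
      smul_mul_assoc, mul_smul_comm, mul_assoc]
  have hlen : ∀ x y, (u ++ x :: y :: v).length = u.length + v.length + 2 := by
    intro x y; simp; omega
  rw [expand, hlow]
  rcases Nat.lt_or_ge n (u.length + v.length + 2) with hn | hn
  · rw [hΨ, hΨ, if_pos (by rw [hlen]; omega), if_pos (by rw [hlen]; omega),
      hf u i j v (by omega), C_of_eq _ _ _ _ (by omega)]
    abel
  · rw [agree _ (by rw [hlen]; omega), agree _ (by rw [hlen]; omega), ← expand]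
    exact hΦ u v i j hn

theorem ColorLieAlgebra.exists_homogeneous_basis (L : ColorLieAlgebra χ V) :
    ∃ (B : Type (max u_1 u_3)) (b : Module.Basis B K V) (deg : B → G),
      (∀ i, b i ∈ L.grading (deg i)) ∧
      ∀ g, L.grading g ≤ Submodule.span K (b '' {i | deg i = g}) := by
  let bas := fun g => Module.Free.chooseBasis K (L.grading g)
  refine ⟨_, L.decomp.collectedBasis bas, Sigma.fst, L.decomp.collectedBasis_mem bas,
    fun g x hx => ?_⟩
  have h := Submodule.mem_map_of_mem (f := (L.grading g).subtype) ((bas g).mem_span ⟨x, hx⟩)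
  rw [Submodule.map_span] at h
  refine Submodule.span_mono ?_ h
  rintro _ ⟨_, ⟨i, rfl⟩, rfl⟩
  exact ⟨⟨g, i⟩, rfl, by simp⟩

/-- Maps killing the relations up to length `n`, compatible for varying `n`. -/
theorem exists_seq_killsRel [CharZero K] {B M : Type*} [AddCommGroup M] [Module K M]
    {L : ColorLieAlgebra χ V} {c : ColorCocycle L} {b : Module.Basis B K V} {deg : B → G}
    (hdeg : ∀ i, b i ∈ L.grading (deg i))
    (hspan : ∀ g, L.grading g ≤ Submodule.span K (b '' {i | deg i = g}))
    {Φ₀ : TensorAlgebra K V →ₗ[K] M} (h₀ : KillsRel L c b deg 1 Φ₀) :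
    ∃ F : ℕ → TensorAlgebra K V →ₗ[K] M, F 0 = Φ₀ ∧
      (∀ n, KillsRel L c b deg (n + 1) (F n)) ∧
      ∀ n (w : List B), w.length ≤ n + 1 → F (n + 1) (wordProd b w) = F n (wordProd b w) := by
  choose! next h_next using fun (n : ℕ) (Φ : TensorAlgebra K V →ₗ[K] M)
    (hΦ : KillsRel L c b deg n Φ) => hΦ.exists_succ hdeg hspan
  let F : ℕ → TensorAlgebra K V →ₗ[K] M := fun n => Nat.rec Φ₀ (fun n Φ => next (n + 1) Φ) n
  have hF : ∀ n, KillsRel L c b deg (n + 1) (F n) := by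
    intro n
    induction n with
    | zero => exact h₀
    | succ n ih => exact (h_next _ _ ih).1
  exact ⟨F, rfl, hF, fun n => (h_next _ _ (hF n)).2⟩

/-- A linear retraction of the tensor algebra onto the generators vanishing on the two-sided
ideal of relations. -/
theorem exists_retraction_killing_relations [CharZero K] (L : ColorLieAlgebra χ V)
    (c : ColorCocycle L) :
    ∃ Φ : TensorAlgebra K V →ₗ[K] V, (∀ x, Φ (ι K x) = x) ∧
      ∀ (s t : TensorAlgebra K V) (g h : G), ∀ x ∈ L.grading g, ∀ y ∈ L.grading h,
        Φ (s * colorRel L c (χ.ε g h) x y * t) = 0 := by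
  obtain ⟨B, b, deg, hdeg, hspan⟩ := L.exists_homogeneous_basis
  obtain ⟨Φ₀, hΦ₀⟩ := exists_linearMap_wordProd b fun w => match w with
    | [i] => b i
    | _ => 0
  obtain ⟨F, hF₀, hF, F_succ⟩ := exists_seq_killsRel (c := c) hdeg hspan (Φ₀ := Φ₀)
    fun u v i j h => absurd h (by omega)
  have F_stable : ∀ (w : List B) n, w.length ≤ n →
      F n (wordProd b w) = F w.length (wordProd b w) := by
    intro w n hn
    induction n, hn using Nat.le_induction with
    | base => rfl
    | succ n hn ih => rw [F_succ n w (by omega), ih]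
  obtain ⟨Φ, hΦ⟩ := exists_linearMap_wordProd b fun w => F w.length (wordProd b w)
  have agree : ∀ n {t : TensorAlgebra K V}, t ∈ wordFil b n → Φ t = F n t := fun n t ht =>
    eqOn_wordFil b (fun w hw => by rw [hΦ, F_stable w n hw]) ht
  have kills : ∀ n, KillsRel L c b deg n Φ := by
    intro n u v i j _
    have hw := fun w : List B => wordProd_mem_wordFil (K := K) b (le_refl w.length)
    rw [agree (u.length + 2 + v.length) (mul_mem_wordFil b
      (mul_mem_wordFil b (hw u) (colorRel_mem_wordFil L c b _ _ _)) (hw v))]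
    exact hF _ u v i j (by omega)
  refine ⟨Φ, fun x => ?_, fun s t g h x hx y hy => ?_⟩
  · refine LinearMap.congr_fun (f := Φ ∘ₗ ι K) (g := LinearMap.id) (b.ext fun i => ?_) x
    have h₁ : ι K (b i) = wordProd b [i] := by simp [wordProd]
    simp only [LinearMap.comp_apply, LinearMap.id_apply]
    rw [h₁, hΦ, List.length_singleton, F_succ 0 _ (by simp), hF₀]
    exact hΦ₀ [i]
  · obtain ⟨p, hp⟩ := exists_mem_wordFil b s
    obtain ⟨q, hq⟩ := exists_mem_wordFil b t
    exact (kills (p + q + 2)).apply_eq_zero hspan le_rfl hp hq hx hy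

/-- A linear form compatible with all two-sided multiples of a relation descends to
the quotient ring. -/
theorem RingQuot.apply_eq_of_mkAlgHom_eq {R A M : Type*} [CommSemiring R] [Semiring A]
    [Algebra R A] [AddCommMonoid M] [Module R M] {r : A → A → Prop} (Φ : A →ₗ[R] M)
    (h : ∀ x y, r x y → ∀ s t, Φ (s * x * t) = Φ (s * y * t)) {x y : A}
    (hxy : RingQuot.mkAlgHom R r x = RingQuot.mkAlgHom R r y) : Φ x = Φ y := by
  let con : RingCon A :=
    { r := fun x y => ∀ s t, Φ (s * x * t) = Φ (s * y * t)
      iseqv := ⟨fun _ _ _ => rfl, fun h s t => (h s t).symm,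
        fun h h' s t => (h s t).trans (h' s t)⟩
      add' := fun {_ _ _ _} h h' s t => by simp only [mul_add, add_mul, map_add, h, h']
      mul' := fun {w x y z} h h' s t => by
        have h₁ := h s (y * t)
        have h₂ := h' (s * x) t
        simp only [mul_assoc] at h₁ h₂ ⊢
        exact h₁.trans h₂ }
  let f := RingQuot.lift (r := r) ⟨con.mk', fun x y hr => con.eq.2 (h x y hr)⟩
  have hf : ∀ a, f (RingQuot.mkAlgHom R r a) = con.mk' a := fun a => by
    rw [← AlgHom.coe_toRingHom, RingQuot.mkAlgHom_coe]
    exact RingQuot.lift_mkRingHom_apply _ _ _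
  have : con x y := con.eq.1 ((hf x).symm.trans ((congrArg f hxy).trans (hf y)))
  simpa using this 1 1

/-- for a `K`-free color Lie algebra `L` and a scalar graded 2-cocycle `ω`,
the canonical map `i_ω : L → U_ω(L)` is injective, and for homogeneous `x, y`,
`i_ω(x) i_ω(y) - ε(|x|,|y|) i_ω(y) i_ω(x) = i_ω([x,y]) + ω(x,y)·1`. -/
theorem Uiota_injective_and_relation [CharZero K]
    (L : ColorLieAlgebra χ V) (c : ColorCocycle L) :
    Function.Injective (Uι L c) ∧
    ∀ g h : G, ∀ x ∈ L.grading g, ∀ y ∈ L.grading h,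
      Uι L c x * Uι L c y - χ.ε g h • (Uι L c y * Uι L c x)
        = Uι L c (L.bracket x y) + algebraMap K (Uenv L c) (c.ω x y) := by
  constructor
  · intro x y hxy
    obtain ⟨Φ, hΦι, hΦ⟩ := exists_retraction_killing_relations L c
    rw [← hΦι x, ← hΦι y]
    refine RingQuot.apply_eq_of_mkAlgHom_eq Φ ?_ hxy
    rintro _ _ ⟨ha, hb⟩ s t
    rw [← sub_eq_zero, ← map_sub, ← sub_mul, ← mul_sub, add_assoc, ← sub_sub,
      ← lowerTerm_apply, ← colorRel_apply]
    exact hΦ s t _ _ _ ha _ hb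
  · intro g h x hx y hy
    have key := RingQuot.mkAlgHom_rel K (URel.rel (L := L) (c := c) hx hy)
    simp only [map_mul, map_add, map_smul, AlgHom.commutes] at key
    rw [sub_eq_iff_eq_add, add_comm, ← add_assoc]
    exact key
end

section
/- Let L be a color Lie algebra and ω a scalar graded 2-cocycle. Equip U_ω(L) with the filtration U_{n,ω}(L) given by the images of the tensors of degree ≤ n, and let G_ω(L) be the associated Z-graded algebra. Then the canonical homomorphism φ_ω from the ε-symmetric algebra S(L) to G_ω(L), extending the composite L → U_ω(L) → G_ω(L), is an isomorphism of (Z × G)-graded algebras. -/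
open TensorAlgebra

variable {G K V : Type*} [CommGroup G] [DecidableEq G] [Field K] [AddCommGroup V] [Module K V]
  {χ : ColorStructure G K}

/-- The defining relations of the `ε`-symmetric algebra `S(V)`. -/
inductive SRel (χ' : ColorStructure G K) (Vg : G → Submodule K V) :
    TensorAlgebra K V → TensorAlgebra K V → Prop
  | rel {g h : G} {a b : V} (ha : a ∈ Vg g) (hb : b ∈ Vg h) :
      SRel χ' Vg (ι K a * ι K b) (χ'.ε g h • (ι K b * ι K a))

/-- The `ε`-symmetric algebra `S(V)` of a graded vector space. -/
def EpsSymAlg (χ' : ColorStructure G K) (Vg : G → Submodule K V) : Type _ :=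
  RingQuot (SRel χ' Vg)

noncomputable instance (χ' : ColorStructure G K) (Vg : G → Submodule K V) :
    Ring (EpsSymAlg χ' Vg) := inferInstanceAs (Ring (RingQuot (SRel χ' Vg)))

noncomputable instance (χ' : ColorStructure G K) (Vg : G → Submodule K V) :
    Algebra K (EpsSymAlg χ' Vg) := inferInstanceAs (Algebra K (RingQuot (SRel χ' Vg)))

/-- The canonical map `V → S(V)`. -/
noncomputable def ESι (χ' : ColorStructure G K) (Vg : G → Submodule K V) :
    V →ₗ[K] EpsSymAlg χ' Vg :=
  (RingQuot.mkAlgHom K (SRel χ' Vg)).toLinearMap ∘ₗ ι K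

/-- The degree-`n` homogeneous component `S^n(V)` of the `ε`-symmetric algebra. -/
noncomputable def ESdeg (χ' : ColorStructure G K) (Vg : G → Submodule K V) (n : ℕ) :
    Submodule K (EpsSymAlg χ' Vg) :=
  Submodule.span K {s | ∃ l : List V, l.length = n ∧ s = (l.map (ESι χ' Vg)).prod}

/-- The `(n,g)`-homogeneous component of the `ε`-symmetric algebra. -/
noncomputable def ESdegG (χ' : ColorStructure G K) (Vg : G → Submodule K V)
    (n : ℕ) (g : G) : Submodule K (EpsSymAlg χ' Vg) :=
  Submodule.span K {s | ∃ l : List (G × V), (∀ p ∈ l, p.2 ∈ Vg p.1) ∧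
    l.length = n ∧ (l.map Prod.fst).prod = g ∧
    s = (l.map fun p => ESι χ' Vg p.2).prod}

namespace ColorPBW

section Averaging

variable {M : Type*} [AddCommGroup M] [Module K M]

/-- Affine involutions satisfying the Coxeter relations of type `A` have a common fixed point. -/
lemma exists_common_fixed_point [CharZero K] (N : Submodule K M) (m : ℕ) :
    ∀ (B : ℕ → M →ₗ[K] M) (f : ℕ → M) (A : ℕ → M → M), (∀ i x, A i x = B i x + f i) →
      (∀ i < m, ∀ x ∈ N, A i x ∈ N) →
      (∀ i < m, ∀ x, A i (A i x) = x) →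
      (∀ i, i + 1 < m → ∀ x, A i (A (i + 1) (A i x)) = A (i + 1) (A i (A (i + 1) x))) →
      (∀ i j, i + 1 < j → j < m → ∀ x, A i (A j x) = A j (A i x)) →
      ∃ x ∈ N, ∀ i < m, A i x = x := by
  induction m with
  | zero => exact fun _ _ _ _ _ _ _ _ => ⟨0, N.zero_mem, by simp⟩
  | succ m ih =>
    intro B f A hA hN hinv hbraid hcomm
    obtain ⟨x, hxN, hx⟩ := ih (fun i => B (i + 1)) (fun i => f (i + 1)) (fun i => A (i + 1))
      (fun i => hA _) (fun i hi => hN _ (by omega)) (fun i hi => hinv _ (by omega))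
      (fun i hi => hbraid _ (by omega)) (fun i j hij hj => hcomm _ _ (by omega) (by omega))
    let y : ℕ → M := fun k => Nat.rec x (fun j z => A j z) k
    have y_zero : y 0 = x := rfl
    have y_succ : ∀ k, y (k + 1) = A k (y k) := fun _ => rfl
    have hyN : ∀ k ≤ m + 1, y k ∈ N := by
      intro k
      induction k with
      | zero => exact fun _ => hxN
      | succ k ihk => exact fun hk => hN k (by omega) _ (ihk (by omega))
    have fix_lt : ∀ k i, k < i → i < m + 1 → A i (y k) = y k := by
      intro k
      induction k with
      | zero =>
        intro i hi him
        obtain ⟨i, rfl⟩ := Nat.exists_eq_succ_of_ne_zero hi.ne'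
        exact hx i (by omega)
      | succ k ihk =>
        intro i hi him
        rw [y_succ, ← hcomm k i hi him, ihk i (by omega) him]
    have fix_gt : ∀ i, i < m + 1 → ∀ j, i + 2 + j ≤ m + 1 → A i (y (i + 2 + j)) = y (i + 2 + j) := by
      intro i hi j
      induction j with
      | zero =>
        intro hj
        rw [add_zero, y_succ (i + 1), y_succ i, hbraid i (by omega),
          fix_lt i (i + 1) (by omega) (by omega)]
      | succ j ihj =>
        intro hj
        rw [show i + 2 + (j + 1) = (i + 2 + j) + 1 by omega, y_succ,
          hcomm i (i + 2 + j) (by omega) (by omega), ihj (by omega)]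
    have hswap : ∀ i < m + 1, ∀ k < m + 2, A i (y k) = y (Equiv.swap i (i + 1) k) := by
      intro i hi k hk
      rcases lt_trichotomy k i with h | rfl | h
      · rw [Equiv.swap_apply_of_ne_of_ne (by omega) (by omega), fix_lt k i h hi]
      · rw [Equiv.swap_apply_left, y_succ]
      · rcases eq_or_ne k (i + 1) with rfl | h'
        · rw [Equiv.swap_apply_right, y_succ, hinv i hi]
        · rw [Equiv.swap_apply_of_ne_of_ne (by omega) h']
          have := fix_gt i hi (k - (i + 2)) (by omega)
          rwa [show i + 2 + (k - (i + 2)) = k by omega] at this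
    have hcard : ((m + 2 : ℕ) : K) ≠ 0 := Nat.cast_ne_zero.mpr (by omega)
    refine ⟨((m + 2 : ℕ) : K)⁻¹ • ∑ k ∈ Finset.range (m + 2), y k,
      N.smul_mem _ (N.sum_mem fun k hk => hyN k (by simp at hk; omega)), fun i hi => ?_⟩
    have hsum : ∑ k ∈ Finset.range (m + 2), A i (y k) = ∑ k ∈ Finset.range (m + 2), y k := by
      rw [Finset.sum_congr rfl fun k hk => hswap i hi k (Finset.mem_range.mp hk)]
      refine Equiv.Perm.sum_comp (Equiv.swap i (i + 1)) _ y fun k hk => ?_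
      by_contra hk'
      simp only [Finset.coe_range, Set.mem_Iio, not_lt] at hk'
      exact hk (Equiv.swap_apply_of_ne_of_ne (by omega) (by omega))
    have hf : f i = ((m + 2 : ℕ) : K)⁻¹ • ∑ k ∈ Finset.range (m + 2), f i := by
      rw [Finset.sum_const, Finset.card_range, ← Nat.cast_smul_eq_nsmul K, smul_smul,
        inv_mul_cancel₀ hcard, one_smul]
    rw [hA, map_smul, map_sum]
    nth_rw 1 [hf]
    rw [← smul_add, ← Finset.sum_add_distrib, ← hsum]
    simp only [hA]

end Averaging

section RingQuot

variable {A M : Type*} [Ring A] [Algebra K A] [AddCommGroup M] [Module K M]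

/-- A linear map compatible with all two-sided translates of a relation is constant on the fibres
of the quotient map by that relation. -/
lemma map_eq_of_ringQuot_eq (r : A → A → Prop) (f : A →ₗ[K] M)
    (h : ∀ x y, r x y → ∀ u v, f (u * x * v) = f (u * y * v)) {x y : A}
    (hxy : RingQuot.mkAlgHom K r x = RingQuot.mkAlgHom K r y) : f x = f y := by
  have hrel : ∀ x y, RingQuot.Rel r x y → ∀ u v, f (u * x * v) = f (u * y * v) := by
    intro x y hxy
    induction hxy with
    | of hxy => exact h _ _ hxy
    | add_left _ ih => intro u v; simp only [mul_add, add_mul, map_add, ih]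
    | @mul_left _ _ c _ ih =>
      intro u v
      simpa only [mul_assoc] using ih u (c * v)
    | @mul_right c _ _ _ ih =>
      intro u v
      simpa only [mul_assoc] using ih (u * c) v
  have heqv : ∀ x y, Relation.EqvGen (RingQuot.Rel r) x y → f x = f y := by
    intro x y hxy
    induction hxy with
    | rel x y hxy => simpa using hrel x y hxy 1 1
    | refl => rfl
    | symm _ _ _ ih => exact ih.symm
    | trans _ _ _ _ _ ih₁ ih₂ => exact ih₁.trans ih₂
  have hxy' : RingQuot.mkRingHom r x = RingQuot.mkRingHom r y := by
    rw [← RingQuot.mkAlgHom_coe K r]; exact hxy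
  refine heqv x y (Quot.eqvGen_exact ?_)
  simpa [RingQuot.mkRingHom_def] using hxy'

/-- A linear map that is constant on the fibres of a surjective linear map factors through it. -/
lemma exists_factorization {A B M : Type*} [AddCommGroup A] [Module K A] [AddCommGroup B]
    [Module K B] [AddCommGroup M] [Module K M] (π : A →ₗ[K] B) (hπ : Function.Surjective π)
    (f : A →ₗ[K] M) (h : ∀ x y, π x = π y → f x = f y) :
    ∃ F : B →ₗ[K] M, ∀ x, F (π x) = f x := by
  refine ⟨{ toFun := fun q => f (Function.surjInv hπ q)
            map_add' := fun p q => ?_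
            map_smul' := fun k q => ?_ }, fun x => h _ _ (Function.surjInv_eq hπ _)⟩
  · rw [← map_add]
    exact h _ _ (by simp only [map_add, Function.surjInv_eq])
  · rw [RingHom.id_apply, ← map_smul]
    exact h _ _ (by simp only [map_smul, Function.surjInv_eq])

end RingQuot

section Words

variable {I M : Type*} [AddCommGroup M] [Module K M] (b : Module.Basis I K V)

/-- The monomial of the tensor algebra attached to a word in a basis. -/
noncomputable def word (w : List I) : TensorAlgebra K V :=
  (w.map fun i => ι K (b i)).prod

@[simp] lemma word_nil : word b [] = 1 := rfl

@[simp] lemma word_cons (i : I) (w : List I) : word b (i :: w) = ι K (b i) * word b w := by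
  simp [word]

@[simp] lemma word_append (u v : List I) : word b (u ++ v) = word b u * word b v := by
  simp [word]

lemma tensorAlgebra_basis_apply (w : List I) :
    b.tensorAlgebra (FreeMonoid.ofList w) = word b w := by
  have h : FreeAlgebra.basisFreeMonoid K I (FreeMonoid.ofList w)
      = (w.map (FreeAlgebra.ι K)).prod := by
    simp [FreeAlgebra.basisFreeMonoid, FreeAlgebra.equivMonoidAlgebraFreeMonoid,
      FreeMonoid.lift_apply]
  simp [Module.Basis.tensorAlgebra, h, word, Function.comp_def, map_list_prod]

/-- The linear map on the tensor algebra with prescribed values on words. -/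
noncomputable def wordLift (f : List I → M) : TensorAlgebra K V →ₗ[K] M :=
  b.tensorAlgebra.constr K fun w => f (FreeMonoid.toList w)

@[simp] lemma wordLift_word (f : List I → M) (w : List I) : wordLift b f (word b w) = f w := by
  rw [← tensorAlgebra_basis_apply, wordLift, Module.Basis.constr_basis, FreeMonoid.toList_ofList]

/-- The span of the words belonging to a given set. -/
noncomputable def wordSpan (P : Set (List I)) : Submodule K (TensorAlgebra K V) :=
  Submodule.span K (word b '' P)

variable {b}

lemma word_mem_wordSpan {P : Set (List I)} {w : List I} (hw : w ∈ P) : word b w ∈ wordSpan b P :=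
  Submodule.subset_span ⟨w, hw, rfl⟩

lemma wordSpan_mono {P Q : Set (List I)} (h : P ⊆ Q) : wordSpan b P ≤ wordSpan b Q :=
  Submodule.span_mono (Set.image_mono h)

lemma mul_mem_wordSpan {P Q R : Set (List I)} (h : ∀ u ∈ P, ∀ v ∈ Q, u ++ v ∈ R)
    {x y : TensorAlgebra K V} (hx : x ∈ wordSpan b P) (hy : y ∈ wordSpan b Q) :
    x * y ∈ wordSpan b R := by
  have hxy := Submodule.mul_mem_mul hx hy
  rw [wordSpan, wordSpan, Submodule.span_mul_span] at hxy
  refine Submodule.span_mono ?_ hxy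
  rintro _ ⟨_, ⟨u, hu, rfl⟩, _, ⟨v, hv, rfl⟩, rfl⟩
  exact ⟨u ++ v, h u hu v hv, word_append b u v⟩

lemma eq_of_eq_on_words {P : Set (List I)} {f g : TensorAlgebra K V →ₗ[K] M}
    (h : ∀ w ∈ P, f (word b w) = g (word b w)) {x : TensorAlgebra K V} (hx : x ∈ wordSpan b P) :
    f x = g x :=
  LinearMap.eqOn_span (by rintro _ ⟨w, hw, rfl⟩; exact h w hw) hx

lemma map_wordSpan_le {P : Set (List I)} {f : TensorAlgebra K V →ₗ[K] M} {N : Submodule K M}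
    (h : ∀ w ∈ P, f (word b w) ∈ N) {x : TensorAlgebra K V} (hx : x ∈ wordSpan b P) : f x ∈ N :=
  Submodule.span_le (p := N.comap f).mpr (by rintro _ ⟨w, hw, rfl⟩; exact h w hw) hx

lemma wordSpan_univ : wordSpan b Set.univ = ⊤ := by
  rw [wordSpan, Set.image_univ, ← b.tensorAlgebra.span_eq]
  congr 1
  ext x
  exact ⟨fun ⟨w, hw⟩ => ⟨FreeMonoid.ofList w, by rw [tensorAlgebra_basis_apply, hw]⟩,
    fun ⟨w, hw⟩ => ⟨FreeMonoid.toList w, by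
      rw [← tensorAlgebra_basis_apply, FreeMonoid.ofList_toList, hw]⟩⟩

lemma ι_mem_wordSpan {J : Set I} {v : V} (hv : v ∈ Submodule.span K (b '' J)) :
    ι K v ∈ wordSpan b {w | ∃ i ∈ J, w = [i]} := by
  refine Submodule.span_le (p := (wordSpan b _).comap (ι K)).mpr ?_ hv
  rintro _ ⟨i, hi, rfl⟩
  simpa using word_mem_wordSpan (b := b) (P := {w | ∃ i ∈ J, w = [i]}) ⟨i, hi, rfl⟩

open Classical in
/-- The projection of the tensor algebra onto the span of a set of words. -/
noncomputable def wordProj (b : Module.Basis I K V) (P : Set (List I)) :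
    TensorAlgebra K V →ₗ[K] TensorAlgebra K V :=
  wordLift b fun w => if w ∈ P then word b w else 0

lemma wordProj_word_mem {P : Set (List I)} {w : List I} (hw : w ∈ P) :
    wordProj b P (word b w) = word b w := by
  simp [wordProj, hw]

lemma wordProj_word_notMem {P : Set (List I)} {w : List I} (hw : w ∉ P) :
    wordProj b P (word b w) = 0 := by
  simp [wordProj, hw]

lemma wordProj_eq_self {P : Set (List I)} {x : TensorAlgebra K V} (hx : x ∈ wordSpan b P) :
    wordProj b P x = x :=
  eq_of_eq_on_words (g := LinearMap.id) (fun _ hw => wordProj_word_mem hw) hx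

lemma wordProj_eq_zero {P Q : Set (List I)} (hPQ : ∀ w ∈ Q, w ∉ P) {x : TensorAlgebra K V}
    (hx : x ∈ wordSpan b Q) : wordProj b P x = 0 :=
  eq_of_eq_on_words (g := 0) (fun w hw => wordProj_word_notMem (hPQ w hw)) hx

end Words

section ColorIdentities

lemma ε_one_left {G K : Type*} [CommGroup G] [Field K] (χ : ColorStructure G K) (g : G) :
    χ.ε 1 g = 1 := by
  have h := χ.mul_left 1 1 g
  rw [one_mul] at h
  have h0 : χ.ε 1 g ≠ 0 := left_ne_zero_of_mul_eq_one (χ.antisym 1 g)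
  exact (mul_eq_left₀ h0).mp h.symm

variable (L : ColorLieAlgebra χ V) (c : ColorCocycle L)

/-- The lower order terms `[v₁,v₂] + ω(v₁,v₂)` of the defining relations of `U_ω(L)`. -/
noncomputable def tailTerm : V →ₗ[K] V →ₗ[K] TensorAlgebra K V :=
  L.bracket.compr₂ (ι K) + c.ω.compr₂ (Algebra.linearMap K (TensorAlgebra K V))

lemma tailTerm_apply (x y : V) :
    tailTerm L c x y = ι K (L.bracket x y) + algebraMap K _ (c.ω x y) := rfl

variable {L} {x y z : V} {g h k : G}

lemma tailTerm_antisymm (hx : x ∈ L.grading g) (hy : y ∈ L.grading h) :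
    tailTerm L c x y = -(χ.ε g h • tailTerm L c y x) := by
  rw [tailTerm_apply, tailTerm_apply, L.bracket_antisym g h x hx y hy, c.antisym g h x hx y hy]
  simp only [map_neg, map_smul, map_mul, Algebra.smul_def]
  rw [mul_add, neg_add]

variable {c} in
lemma ω_mul_ε (hx : x ∈ L.grading g) (hy : y ∈ L.grading h) (k : G) :
    χ.ε (g * h) k * c.ω x y = c.ω x y := by
  by_cases hgh : g * h = 1
  · rw [hgh, ε_one_left, one_mul]
  · rw [c.degree_zero g h hgh x hx y hy, mul_zero]

lemma bracket_bracket (hx : x ∈ L.grading g) (hy : y ∈ L.grading h) (hz : z ∈ L.grading k) :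
    L.bracket (L.bracket x y) z
      = L.bracket x (L.bracket y z) + χ.ε h k • L.bracket (L.bracket x z) y := by
  have hJ := L.jacobi g h k x hx y hy z hz
  rw [L.bracket_antisym k (g * h) z hz _ (L.bracket_grade g h x hx y hy),
    L.bracket_antisym k g z hz x hx, map_neg, map_smul,
    L.bracket_antisym h (g * k) y hy _ (L.bracket_grade g k x hx z hz), χ.mul_right,
    χ.mul_right] at hJ
  have h₁ := χ.antisym g h
  have h₂ := χ.antisym h k
  have h₃ := χ.antisym g k
  have h0 : χ.ε k g ≠ 0 := right_ne_zero_of_mul_eq_one h₃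
  apply smul_right_injective V h0
  dsimp only
  linear_combination (norm := module) (-1 : K) • hJ
    + (χ.ε k g * χ.ε h k * h₁) • L.bracket (L.bracket x z) y
    - (χ.ε k g * h₂) • L.bracket (L.bracket x y) z

lemma ω_bracket (hx : x ∈ L.grading g) (hy : y ∈ L.grading h) (hz : z ∈ L.grading k) :
    c.ω (L.bracket x y) z
      = c.ω x (L.bracket y z) + χ.ε h k * c.ω (L.bracket x z) y := by
  have hJ := c.cocycle g h k x hx y hy z hz
  rw [c.antisym k (g * h) z hz _ (L.bracket_grade g h x hx y hy),
    L.bracket_antisym k g z hz x hx, map_neg, map_smul, smul_eq_mul,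
    c.antisym h (g * k) y hy _ (L.bracket_grade g k x hx z hz), χ.mul_right,
    χ.mul_right] at hJ
  have h₁ := χ.antisym g h
  have h₂ := χ.antisym h k
  have h0 : χ.ε k g ≠ 0 := right_ne_zero_of_mul_eq_one (χ.antisym g k)
  apply mul_left_cancel₀ h0
  linear_combination -hJ + χ.ε k g * χ.ε h k * c.ω (L.bracket x z) y * h₁
    - χ.ε k g * c.ω (L.bracket x y) z * h₂

end ColorIdentities

section Straightening

variable (L : ColorLieAlgebra χ V) (c : ColorCocycle L)

/-- The quotient map from the tensor algebra to `U_ω(L)`. -/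
noncomputable def toUenv : TensorAlgebra K V →ₐ[K] Uenv L c := RingQuot.mkAlgHom K (URel L c)

/-- The quotient map from the tensor algebra to the `ε`-symmetric algebra. -/
noncomputable def toEps : TensorAlgebra K V →ₐ[K] EpsSymAlg χ L.grading :=
  RingQuot.mkAlgHom K (SRel χ L.grading)

lemma toUenv_surjective : Function.Surjective (toUenv L c) :=
  RingQuot.mkAlgHom_surjective K (URel L c)

lemma toEps_surjective : Function.Surjective (toEps L) :=
  RingQuot.mkAlgHom_surjective K (SRel χ L.grading)

variable {L} in
lemma toUenv_ι_mul_ι {g h : G} {x y : V} (hx : x ∈ L.grading g) (hy : y ∈ L.grading h) :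
    toUenv L c (ι K x * ι K y)
      = toUenv L c (χ.ε g h • (ι K y * ι K x) + tailTerm L c x y) := by
  rw [tailTerm_apply, ← add_assoc]
  exact RingQuot.mkAlgHom_rel K (URel.rel hx hy)

variable {L} in
lemma toEps_ι_mul_ι {g h : G} {x y : V} (hx : x ∈ L.grading g) (hy : y ∈ L.grading h) :
    toEps L (ι K x * ι K y) = toEps L (χ.ε g h • (ι K y * ι K x)) :=
  RingQuot.mkAlgHom_rel K (SRel.rel hx hy)

lemma exists_homogeneous_basis (L : ColorLieAlgebra χ V) :
    ∃ b : Module.Basis (Σ g, Module.Basis.ofVectorSpaceIndex K (L.grading g)) K V,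
      (∀ i, b i ∈ L.grading i.1) ∧
      ∀ g, ∀ v ∈ L.grading g, v ∈ Submodule.span K (b '' {i | i.1 = g}) := by
  let v := fun g => Module.Basis.ofVectorSpace K (L.grading g)
  refine ⟨L.decomp.collectedBasis v, L.decomp.collectedBasis_mem v,
    fun g x hx => ?_⟩
  have hx' := (v g).mem_span ⟨x, hx⟩
  have := Submodule.mem_map_of_mem (f := (L.grading g).subtype) hx'
  rw [Submodule.map_span] at this
  refine Submodule.span_mono ?_ this
  rintro _ ⟨_, ⟨i, rfl⟩, rfl⟩
  exact ⟨⟨g, i⟩, rfl, by simp⟩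


variable {I : Type*} (b : Module.Basis I K V)

/-- The filtration of the tensor algebra by word length. -/
noncomputable def tensorFil (n : ℕ) : Submodule K (TensorAlgebra K V) :=
  wordSpan b {w | w.length ≤ n}

variable {b}

lemma tensorFil_mono {m n : ℕ} (h : m ≤ n) : tensorFil b m ≤ tensorFil b n :=
  wordSpan_mono fun _ hw => le_trans hw h

lemma word_mem_tensorFil {w : List I} {n : ℕ} (h : w.length ≤ n) : word b w ∈ tensorFil b n :=
  word_mem_wordSpan h

lemma mul_mem_tensorFil {m n : ℕ} {x y : TensorAlgebra K V} (hx : x ∈ tensorFil b m)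
    (hy : y ∈ tensorFil b n) : x * y ∈ tensorFil b (m + n) :=
  mul_mem_wordSpan (fun u hu v hv => by simp only [Set.mem_ofPred_eq, List.length_append] at *; omega)
    hx hy

lemma one_mem_tensorFil (n : ℕ) : (1 : TensorAlgebra K V) ∈ tensorFil b n :=
  word_mem_tensorFil (b := b) (w := []) (by simp)

lemma ι_mem_tensorFil (v : V) : ι K v ∈ tensorFil b 1 := by
  refine wordSpan_mono ?_ (ι_mem_wordSpan (b := b) (J := Set.univ) (v := v) ?_)
  · rintro _ ⟨i, -, rfl⟩
    simp
  · rw [Set.image_univ, b.span_eq]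
    trivial

lemma tailTerm_mem_tensorFil (x y : V) : tailTerm L c x y ∈ tensorFil b 1 := by
  rw [tailTerm_apply, Algebra.algebraMap_eq_smul_one]
  exact add_mem (ι_mem_tensorFil _) (Submodule.smul_mem _ _ (one_mem_tensorFil 1))

/-- The defining relation of the `ε`-symmetric algebra for elements of degrees `g` and `h`. -/
noncomputable def swapTerm (χ : ColorStructure G K) (g h : G) : V →ₗ[K] V →ₗ[K] TensorAlgebra K V :=
  (LinearMap.mul K (TensorAlgebra K V)).compl₁₂ (ι K) (ι K)
    - χ.ε g h • ((LinearMap.mul K (TensorAlgebra K V)).compl₁₂ (ι K) (ι K)).flip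

omit [DecidableEq G] in
lemma swapTerm_apply (χ : ColorStructure G K) (g h : G) (x y : V) :
    swapTerm χ g h x y = ι K x * ι K y - χ.ε g h • (ι K y * ι K x) := rfl

/-- The defining relation of `U_ω(L)` for elements of degrees `g` and `h`. -/
noncomputable def relTerm (g h : G) : V →ₗ[K] V →ₗ[K] TensorAlgebra K V :=
  swapTerm χ g h - tailTerm L c

lemma relTerm_apply (g h : G) (x y : V) : relTerm L c g h x y
    = ι K x * ι K y - χ.ε g h • (ι K y * ι K x) - tailTerm L c x y := rfl

lemma relTerm_mem_tensorFil (g h : G) (x y : V) : relTerm L c g h x y ∈ tensorFil b 2 := by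
  have h_mul : ∀ v w : V, ι K v * ι K w ∈ tensorFil b 2 := fun v w =>
    mul_mem_tensorFil (m := 1) (n := 1) (ι_mem_tensorFil v) (ι_mem_tensorFil w)
  rw [relTerm_apply]
  exact sub_mem (sub_mem (h_mul x y) (Submodule.smul_mem _ _ (h_mul y x)))
    (tensorFil_mono one_le_two (tailTerm_mem_tensorFil L c x y))

/-- A linear map killing a bilinear expression in basis vectors, between words, kills it between
arbitrary elements. -/
lemma map_mul_mul_eq_zero {L : ColorLieAlgebra χ V} {d : I → G}
    (hspan : ∀ g, ∀ v ∈ L.grading g, v ∈ Submodule.span K (b '' {i | d i = g}))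
    {M : Type*} [AddCommGroup M] [Module K M] {f : TensorAlgebra K V →ₗ[K] M}
    (R : V →ₗ[K] V →ₗ[K] TensorAlgebra K V) {P Q : Set (List I)} {g h : G}
    (hf : ∀ u ∈ P, ∀ v ∈ Q, ∀ i, d i = g → ∀ j, d j = h →
      f (word b u * R (b i) (b j) * word b v) = 0)
    {U W : TensorAlgebra K V} (hU : U ∈ wordSpan b P) (hW : W ∈ wordSpan b Q) {x y : V}
    (hx : x ∈ L.grading g) (hy : y ∈ L.grading h) : f (U * R x y * W) = 0 := by
  refine eq_of_eq_on_words (g := 0)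
    (f := f ∘ₗ LinearMap.mulRight K W ∘ₗ LinearMap.mulRight K (R x y)) (fun u hu => ?_) hU
  refine eq_of_eq_on_words (g := 0)
    (f := f ∘ₗ LinearMap.mulLeft K (word b u * R x y)) (fun v hv => ?_) hW
  refine LinearMap.eqOn_span (g := 0) (f := f ∘ₗ LinearMap.mulRight K (word b v) ∘ₗ
    LinearMap.mulLeft K (word b u) ∘ₗ R.flip y) ?_ (hspan g x hx)
  rintro _ ⟨i, hi, rfl⟩
  refine LinearMap.eqOn_span (g := 0) (f := f ∘ₗ LinearMap.mulRight K (word b v) ∘ₗ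
    LinearMap.mulLeft K (word b u) ∘ₗ R (b i)) ?_ (hspan h y hy)
  rintro _ ⟨j, hj, rfl⟩
  exact hf u hu v hv i hi j hj

variable (b) in
/-- A linear map to the `ε`-symmetric algebra that, up to length `n`, respects the defining
relations of `U_ω(L)` and is the canonical projection modulo terms of lower degree. -/
structure IsStraightening (d : I → G) (n : ℕ)
    (σ : TensorAlgebra K V →ₗ[K] EpsSymAlg χ L.grading) : Prop where
  apply_one : σ 1 = 1
  map_rel : ∀ (u v : List I) (x y : I), u.length + v.length + 2 ≤ n →
    σ (word b u * relTerm L c (d x) (d y) (b x) (b y) * word b v) = 0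
  map_word : ∀ (k : ℕ) (w : List I), k + 1 ≤ n → w.length = k + 1 →
    σ (word b w) - toEps L (word b w) ∈ (tensorFil b k).map (toEps L).toLinearMap

variable {L c} {d : I → G} {n : ℕ} {σ σ' : TensorAlgebra K V →ₗ[K] EpsSymAlg χ L.grading}

namespace IsStraightening

lemma congr (hσ : IsStraightening L c b d n σ) (h : ∀ x ∈ tensorFil b n, σ' x = σ x) :
    IsStraightening L c b d n σ' where
  apply_one := (h 1 (one_mem_tensorFil n)).trans hσ.apply_one
  map_rel u v x y huv := by
    rw [h _ (tensorFil_mono (by omega : u.length + 2 + v.length ≤ n)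
      (mul_mem_tensorFil (mul_mem_tensorFil (word_mem_tensorFil le_rfl)
        (relTerm_mem_tensorFil L c _ _ _ _)) (word_mem_tensorFil le_rfl))), hσ.map_rel u v x y huv]
  map_word k w hk hw := by
    rw [h _ (word_mem_tensorFil (by omega))]
    exact hσ.map_word k w hk hw

lemma map_mem (hσ : IsStraightening L c b d n σ) {k : ℕ} (hk : k ≤ n) {x : TensorAlgebra K V}
    (hx : x ∈ tensorFil b k) : σ x ∈ (tensorFil b k).map (toEps L).toLinearMap := by
  refine map_wordSpan_le (fun w hw => ?_) hx
  rcases hl : w.length with _ | m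
  · rw [List.length_eq_zero_iff.mp hl, word_nil, hσ.apply_one]
    exact ⟨1, one_mem_tensorFil k, map_one (toEps L)⟩
  · have hw : w.length ≤ k := hw
    rw [← sub_add_cancel (σ (word b w)) (toEps L (word b w))]
    exact add_mem (Submodule.map_mono (tensorFil_mono (by omega))
      (hσ.map_word m w (by omega) hl)) ⟨_, word_mem_tensorFil hw, rfl⟩

variable (hspan : ∀ g, ∀ v ∈ L.grading g, v ∈ Submodule.span K (b '' {i | d i = g}))
include hspan

lemma map_relTerm (hσ : IsStraightening L c b d n σ) {p q : ℕ} (hpq : p + q + 2 ≤ n)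
    {U W : TensorAlgebra K V} (hU : U ∈ tensorFil b p) (hW : W ∈ tensorFil b q) {g h : G} {x y : V}
    (hx : x ∈ L.grading g) (hy : y ∈ L.grading h) : σ (U * relTerm L c g h x y * W) = 0 := by
  exact map_mul_mul_eq_zero hspan _ (fun u (hu : u.length ≤ p) v (hv : v.length ≤ q) i hi j hj => by
    subst hi hj
    exact hσ.map_rel u v i j (by omega)) hU hW hx hy

lemma map_swap (hσ : IsStraightening L c b d n σ) {p q : ℕ} (hpq : p + q + 2 ≤ n)
    {U W : TensorAlgebra K V} (hU : U ∈ tensorFil b p) (hW : W ∈ tensorFil b q) {g h : G} {x y : V}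
    (hx : x ∈ L.grading g) (hy : y ∈ L.grading h) :
    σ (U * (ι K x * ι K y) * W)
      = χ.ε g h • σ (U * (ι K y * ι K x) * W) + σ (U * tailTerm L c x y * W) := by
  have := hσ.map_relTerm hspan hpq hU hW hx hy
  rw [relTerm_apply] at this
  simp only [mul_sub, sub_mul, map_sub, mul_smul_comm, smul_mul_assoc, map_smul] at this
  rw [← sub_eq_zero, ← this]
  abel

/-- Moving a letter past the lower order terms of a relation. -/
lemma map_tailTerm_mul (hσ : IsStraightening L c b d n σ) {p q : ℕ} (hpq : p + q + 2 ≤ n)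
    {U W : TensorAlgebra K V} (hU : U ∈ tensorFil b p) (hW : W ∈ tensorFil b q) {g h k : G}
    {x y z : V} (hx : x ∈ L.grading g) (hy : y ∈ L.grading h) (hz : z ∈ L.grading k) :
    σ (U * (tailTerm L c x y * ι K z) * W)
      = χ.ε (g * h) k • σ (U * (ι K z * tailTerm L c x y) * W)
        + σ (U * tailTerm L c (L.bracket x y) z * W) := by
  have := hσ.map_swap hspan hpq hU hW (L.bracket_grade g h x hx y hy) hz
  have hω := congrArg (· • σ (U * ι K z * W)) (ω_mul_ε (c := c) hx hy k)
  rw [tailTerm_apply L c x y]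
  simp only [Algebra.algebraMap_eq_smul_one, mul_add, add_mul, map_add, smul_mul_assoc,
    mul_smul_comm, one_mul, mul_one, map_smul, smul_add, this, smul_smul, hω]
  abel

lemma braid_tailTerm (hσ : IsStraightening L c b d n σ) {p q : ℕ} (hpq : p + q + 2 ≤ n)
    {U W : TensorAlgebra K V} (hU : U ∈ tensorFil b p) (hW : W ∈ tensorFil b q) {g h k : G}
    {x y z : V} (hx : x ∈ L.grading g) (hy : y ∈ L.grading h) (hz : z ∈ L.grading k) :
    (χ.ε g h * χ.ε g k) • σ (U * (tailTerm L c y z * ι K x) * W)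
        + χ.ε g h • σ (U * (ι K y * tailTerm L c x z) * W)
        + σ (U * (tailTerm L c x y * ι K z) * W)
      = (χ.ε h k * χ.ε g k) • σ (U * (ι K z * tailTerm L c x y) * W)
        + χ.ε h k • σ (U * (tailTerm L c x z * ι K y) * W)
        + σ (U * (ι K x * tailTerm L c y z) * W) := by
  have h₁ := hσ.map_tailTerm_mul hspan hpq hU hW hx hy hz
  have h₂ := hσ.map_tailTerm_mul hspan hpq hU hW hy hz hx
  have h₃ := hσ.map_tailTerm_mul hspan hpq hU hW hx hz hy
  have t₁ : tailTerm L c (L.bracket x y) z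
      = tailTerm L c x (L.bracket y z) + χ.ε h k • tailTerm L c (L.bracket x z) y := by
    simp only [tailTerm_apply, bracket_bracket hx hy hz, ω_bracket c hx hy hz, map_add, map_smul,
      Algebra.algebraMap_eq_smul_one, mul_smul, smul_add]
    abel
  have t₂ := tailTerm_antisymm c (L.bracket_grade h k y hy z hz) hx
  rw [t₁, mul_add, add_mul, map_add, mul_smul_comm, smul_mul_assoc, map_smul] at h₁
  rw [t₂, mul_neg, neg_mul, map_neg, mul_smul_comm, smul_mul_assoc, map_smul] at h₂
  rw [χ.mul_left] at h₁ h₂ h₃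
  have e₁ := χ.antisym g h
  have e₂ := χ.antisym g k
  have e₃ := χ.antisym h k
  have e₄ : χ.ε g h * χ.ε g k * (χ.ε h g * χ.ε k g) = 1 := by
    linear_combination χ.ε g k * χ.ε k g * e₁ + e₂
  have h₂' := congrArg ((χ.ε g h * χ.ε g k) • ·) h₂
  have h₃' := congrArg (χ.ε h k • ·) h₃
  have e₅ : χ.ε h k * (χ.ε g h * χ.ε k h) = χ.ε g h := by
    linear_combination χ.ε g h * e₃
  simp only [smul_add, smul_neg, smul_smul, e₄, one_smul, e₅] at h₂' h₃'
  rw [h₁, h₂', h₃']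
  module

end IsStraightening

section WordMoves

variable {S : Type*} [AddCommGroup S] [Module K S]

/-- Interchange the letters at positions `i` and `i + 1`. -/
def swapAt : ℕ → List I → List I
  | 0, x :: y :: v => y :: x :: v
  | i + 1, x :: v => x :: swapAt i v
  | _, w => w

/-- The value of `e` on the letters at positions `i` and `i + 1`. -/
def coefAt (e : I → I → K) : ℕ → List I → K
  | 0, x :: y :: _ => e x y
  | i + 1, _ :: v => coefAt e i v
  | _, _ => 0

/-- The word with the letters at positions `i` and `i + 1` contracted by `t`. -/
noncomputable def contractAt (b : Module.Basis I K V) (t : I → I → TensorAlgebra K V) :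
    ℕ → List I → TensorAlgebra K V
  | 0, x :: y :: v => t x y * word b v
  | i + 1, x :: v => ι K (b x) * contractAt b t i v
  | _, _ => 0

lemma swapAt_append (u v : List I) (x y : I) :
    swapAt u.length (u ++ x :: y :: v) = u ++ y :: x :: v := by
  induction u with
  | nil => rfl
  | cons a u ih => simp [swapAt, ih]

lemma coefAt_append (e : I → I → K) (u v : List I) (x y : I) :
    coefAt e u.length (u ++ x :: y :: v) = e x y := by
  induction u with
  | nil => rfl
  | cons a u ih => simp [coefAt, ih]

lemma contractAt_append (t : I → I → TensorAlgebra K V) (u v : List I) (x y : I) :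
    contractAt b t u.length (u ++ x :: y :: v) = word b u * t x y * word b v := by
  induction u with
  | nil => simp [contractAt]
  | cons a u ih => simp [contractAt, ih, mul_assoc]

lemma length_swapAt (i : ℕ) (w : List I) : (swapAt i w).length = w.length := by
  fun_induction swapAt i w <;> simp_all

lemma exists_eq_append_cons_cons {i : ℕ} {w : List I} (h : i + 1 < w.length) :
    ∃ u x y v, w = u ++ x :: y :: v ∧ u.length = i :=
  ⟨w.take i, w[i], w[i + 1], w.drop (i + 2), by simp, by simp; omega⟩

variable (b)

/-- The affine operator on functions on words of length `N` that precomposes with the `ε`-twisted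
interchange at position `i` and adds the contribution of the contracted word. -/
noncomputable def swapOp (N : ℕ) (e : I → I → K) (t : I → I → TensorAlgebra K V)
    (σ : TensorAlgebra K V →ₗ[K] S) (i : ℕ) (δ : {w : List I // w.length = N} → S) :
    {w : List I // w.length = N} → S :=
  fun w => coefAt e i w.1 • δ ⟨swapAt i w.1, (length_swapAt i w.1).trans w.2⟩
    + σ (contractAt b t i w.1)

variable {b}

lemma swapOp_apply {N : ℕ} {e : I → I → K} {t : I → I → TensorAlgebra K V}
    {σ : TensorAlgebra K V →ₗ[K] S} {i : ℕ} (δ : {w : List I // w.length = N} → S) {w : List I}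
    (hw : w.length = N) (u v : List I) (x y : I) (h : w = u ++ x :: y :: v) (hi : u.length = i) :
    swapOp b N e t σ i δ ⟨w, hw⟩
      = e x y • δ ⟨u ++ y :: x :: v, by simpa [h] using hw⟩
        + σ (word b u * t x y * word b v) := by
  subst h hi
  simp only [swapOp, coefAt_append, contractAt_append, swapAt_append]

end WordMoves

variable (hd : ∀ i, b i ∈ L.grading (d i))
  (hspan : ∀ g, ∀ v ∈ L.grading g, v ∈ Submodule.span K (b '' {i | d i = g}))
include hd hspan

/-- The corrections needed to extend a straightening to words of length `n + 1`. -/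
lemma IsStraightening.exists_correction [CharZero K] (hσ : IsStraightening L c b d n σ) :
    ∃ δ : {w : List I // w.length = n + 1} → EpsSymAlg χ L.grading,
      (∀ w, δ w ∈ (tensorFil b n).map (toEps L).toLinearMap) ∧
      ∀ i < n, swapOp b (n + 1) (fun x y => χ.ε (d x) (d y))
        (fun x y => tailTerm L c (b x) (b y)) σ i δ = δ := by
  let N : Submodule K ({w : List I // w.length = n + 1} → EpsSymAlg χ L.grading) :=
    Submodule.pi Set.univ fun _ => (tensorFil b n).map (toEps L).toLinearMap
  have hN : ∀ δ, δ ∈ N ↔ ∀ w, δ w ∈ (tensorFil b n).map (toEps L).toLinearMap :=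
    fun δ => by simp [N]
  simp only [← hN]
  have tail_mem := fun x y => tailTerm_mem_tensorFil (b := b) L c (b x) (b y)
  refine exists_common_fixed_point N n
    (fun i => LinearMap.pi fun w => coefAt (fun x y => χ.ε (d x) (d y)) i w.1 •
      LinearMap.proj (⟨swapAt i w.1, (length_swapAt i w.1).trans w.2⟩ : {w : List I // w.length = n + 1}))
    (fun i w => σ (contractAt b (fun x y => tailTerm L c (b x) (b y)) i w.1))
    _ (fun i δ => by ext w; simp [swapOp]) ?_ ?_ ?_ ?_
  · intro i hi δ hδ
    rw [hN] at hδ ⊢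
    rintro ⟨w, hw⟩
    obtain ⟨u, x, y, v, rfl, rfl⟩ := exists_eq_append_cons_cons (i := i) (w := w) (by omega)
    rw [swapOp_apply δ hw u v x y rfl rfl]
    refine add_mem (Submodule.smul_mem _ _ (hδ _)) (hσ.map_mem le_rfl ?_)
    simp only [List.length_append, List.length_cons] at hw
    exact tensorFil_mono (by omega : u.length + 1 + v.length ≤ n) (mul_mem_tensorFil
      (mul_mem_tensorFil (word_mem_tensorFil le_rfl) (tail_mem x y)) (word_mem_tensorFil le_rfl))
  · intro i hi δ
    ext1 ⟨w, hw⟩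
    obtain ⟨u, x, y, v, rfl, rfl⟩ := exists_eq_append_cons_cons (i := i) (w := w) (by omega)
    rw [swapOp_apply _ hw u v x y rfl rfl, swapOp_apply _ _ u v y x rfl rfl,
      tailTerm_antisymm c (hd x) (hd y), smul_add, smul_smul, χ.antisym, one_smul]
    simp
  · intro i hi δ
    ext1 ⟨w, hw⟩
    obtain ⟨u, x, y, v, rfl, rfl⟩ := exists_eq_append_cons_cons (i := i) (w := w) (by omega)
    obtain ⟨z, v, rfl⟩ : ∃ z v', v = z :: v' := by
      refine List.exists_cons_of_length_pos ?_
      simp only [List.length_append, List.length_cons] at hw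
      omega
    rw [swapOp_apply _ hw u (z :: v) x y rfl rfl,
      swapOp_apply _ _ (u ++ [y]) v x z (by simp) (by simp),
      swapOp_apply _ _ u (x :: v) y z (by simp) rfl,
      swapOp_apply _ hw (u ++ [x]) v y z (by simp) (by simp),
      swapOp_apply _ _ u (y :: v) x z (by simp) rfl,
      swapOp_apply _ _ (u ++ [z]) v x y (by simp) (by simp)]
    simp only [List.length_append, List.length_cons] at hw
    have key := hσ.braid_tailTerm hspan (by omega : u.length + v.length + 2 ≤ n)
      (word_mem_tensorFil le_rfl) (word_mem_tensorFil le_rfl) (hd x) (hd y) (hd z)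
    simp only [word_append, word_cons, word_nil, mul_one, List.append_assoc, List.cons_append,
      List.nil_append, mul_assoc] at key ⊢
    linear_combination (norm := module) key
  · intro i j hij hj δ
    ext1 ⟨w, hw⟩
    obtain ⟨u, x, y, v, rfl, rfl⟩ := exists_eq_append_cons_cons (i := i) (w := w) (by omega)
    have hw' := hw
    simp only [List.length_append, List.length_cons] at hw'
    obtain ⟨s, z, t, v, rfl, hs⟩ := exists_eq_append_cons_cons (i := j - (u.length + 2)) (w := v)
      (by omega)
    simp only [List.length_append, List.length_cons] at hw'
    rw [swapOp_apply _ hw u (s ++ z :: t :: v) x y rfl rfl,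
      swapOp_apply _ _ (u ++ y :: x :: s) v z t (by simp) (by simp; omega),
      swapOp_apply _ hw (u ++ x :: y :: s) v z t (by simp) (by simp; omega),
      swapOp_apply _ _ u (s ++ t :: z :: v) x y (by simp) rfl]
    have k₁ := hσ.map_swap hspan (by omega : (u.length + 1 + s.length) + v.length + 2 ≤ n)
      (mul_mem_tensorFil (mul_mem_tensorFil (word_mem_tensorFil le_rfl) (tail_mem x y))
        (word_mem_tensorFil le_rfl)) (word_mem_tensorFil le_rfl) (hd z) (hd t)
    have k₂ := hσ.map_swap hspan (by omega : u.length + (s.length + 1 + v.length) + 2 ≤ n)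
      (word_mem_tensorFil le_rfl)
      (mul_mem_tensorFil (mul_mem_tensorFil (word_mem_tensorFil le_rfl) (tail_mem z t))
        (word_mem_tensorFil le_rfl)) (hd x) (hd y)
    simp only [word_append, word_cons, List.append_assoc, List.cons_append, mul_assoc] at k₁ k₂ ⊢
    linear_combination (norm := module) k₁ - k₂

lemma IsStraightening.exists_succ [CharZero K] (hσ : IsStraightening L c b d n σ) :
    ∃ σ', IsStraightening L c b d (n + 1) σ' ∧ ∀ x ∈ tensorFil b n, σ' x = σ x := by
  obtain ⟨δ, hδ, hfix⟩ := hσ.exists_correction hd hspan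
  let σ' := wordLift b fun w =>
    if h : w.length = n + 1 then toEps L (word b w) + δ ⟨w, h⟩ else σ (word b w)
  have h_word : ∀ w (h : w.length = n + 1), σ' (word b w) = toEps L (word b w) + δ ⟨w, h⟩ :=
    fun w h => by simp [σ', h]
  have h_agree : ∀ x ∈ tensorFil b n, σ' x = σ x := fun x hx =>
    eq_of_eq_on_words (fun w hw => by
      have hw : w.length ≤ n := hw
      simp [σ', show w.length ≠ n + 1 by omega]) hx
  have hσ' := hσ.congr h_agree
  refine ⟨σ', ⟨hσ'.apply_one, fun u v x y huv => ?_, fun k w hk hw => ?_⟩, h_agree⟩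
  · rcases huv.lt_or_eq with h | h
    · exact hσ'.map_rel u v x y (by omega)
    have h_mem : word b u * tailTerm L c (b x) (b y) * word b v ∈ tensorFil b n :=
      tensorFil_mono (by omega : u.length + 1 + v.length ≤ n) (mul_mem_tensorFil
        (mul_mem_tensorFil (word_mem_tensorFil le_rfl) (tailTerm_mem_tensorFil L c _ _))
        (word_mem_tensorFil le_rfl))
    have h_word_mul : ∀ x y, word b u * (ι K (b x) * ι K (b y)) * word b v
        = word b (u ++ x :: y :: v) := fun x y => by simp [mul_assoc]
    have h_len : ∀ x y, (u ++ x :: y :: v).length = n + 1 := fun x y => by simp; omega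
    have h_fix := congrFun (hfix u.length (by omega)) ⟨u ++ x :: y :: v, h_len x y⟩
    rw [swapOp_apply δ _ u v x y rfl rfl] at h_fix
    have h_eps : toEps L (word b (u ++ x :: y :: v))
        = χ.ε (d x) (d y) • toEps L (word b (u ++ y :: x :: v)) := by
      rw [← h_word_mul, ← h_word_mul, map_mul, map_mul, toEps_ι_mul_ι (hd x) (hd y)]
      simp
    rw [relTerm_apply]
    simp only [mul_sub, sub_mul, map_sub, mul_smul_comm, smul_mul_assoc, map_smul, h_word_mul]
    rw [h_agree _ h_mem, h_word _ (h_len x y), h_word _ (h_len y x), h_eps, ← h_fix]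
    module
  · rcases hk.lt_or_eq with h | h
    · exact hσ'.map_word k w (by omega) hw
    · obtain rfl : k = n := by omega
      rw [h_word w hw, add_sub_cancel_left]
      exact hδ _

omit hd hspan in
lemma exists_isStraightening [CharZero K] (L : ColorLieAlgebra χ V) (c : ColorCocycle L)
    (hd : ∀ i, b i ∈ L.grading (d i))
    (hspan : ∀ g, ∀ v ∈ L.grading g, v ∈ Submodule.span K (b '' {i | d i = g})) :
    ∃ σ, ∀ n, IsStraightening L c b d n σ := by
  have h_zero : IsStraightening L c b d 0 (toEps L).toLinearMap :=
    ⟨map_one (toEps L), fun u v x y h => by omega, fun k w h => by omega⟩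
  have h_step : ∀ n (s : {σ // IsStraightening L c b d n σ}),
      ∃ s' : {σ // IsStraightening L c b d (n + 1) σ}, ∀ x ∈ tensorFil b n, s'.1 x = s.1 x :=
    fun n s => let ⟨σ', h, h'⟩ := s.2.exists_succ hd hspan; ⟨⟨σ', h⟩, h'⟩
  choose next h_next using h_step
  let s : ∀ n, {σ // IsStraightening L c b d n σ} := fun n => Nat.rec ⟨_, h_zero⟩ next n
  have h_stable : ∀ m n, m ≤ n → ∀ x ∈ tensorFil b m, (s n).1 x = (s m).1 x := by
    intro m n hmn
    induction n, hmn using Nat.le_induction with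
    | base => exact fun _ _ => rfl
    | succ n hmn ih => exact fun x hx => (h_next n (s n) x (tensorFil_mono hmn hx)).trans (ih x hx)
  refine ⟨wordLift b fun w => (s w.length).1 (word b w), fun n => (s n).2.congr fun x hx => ?_⟩
  refine eq_of_eq_on_words (fun w hw => ?_) hx
  rw [wordLift_word, h_stable _ n hw _ (word_mem_tensorFil le_rfl)]

end Straightening

section Comparison

variable {I A : Type*} [Ring A] [Algebra K A] {b : Module.Basis I K V} {d : I → G}
  {L : ColorLieAlgebra χ V} {c : ColorCocycle L} {M : Type*} [AddCommGroup M] [Module K M]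

/-- The product of the degrees of the letters of a word. -/
def wordDeg (d : I → G) (w : List I) : G := (w.map d).prod

lemma mem_wordSpan_of_mem_grading
    (hspan : ∀ g, ∀ v ∈ L.grading g, v ∈ Submodule.span K (b '' {i | d i = g})) {g : G} {v : V}
    (hv : v ∈ L.grading g) : ι K v ∈ wordSpan b {w | w.length = 1 ∧ wordDeg d w = g} := by
  refine wordSpan_mono ?_ (ι_mem_wordSpan (hspan g v hv))
  rintro _ ⟨i, rfl, rfl⟩
  simp [wordDeg]

lemma list_prod_mem_wordSpan (l : List V) :
    (l.map (ι K)).prod ∈ wordSpan b {w | w.length = l.length} := by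
  induction l with
  | nil => exact word_mem_wordSpan (b := b) (w := []) rfl
  | cons v l ih =>
    rw [List.map_cons, List.prod_cons]
    refine mul_mem_wordSpan ?_ (ι_mem_wordSpan (b := b) (J := Set.univ) (v := v)
      (by rw [Set.image_univ, b.span_eq]; trivial)) ih
    rintro _ ⟨i, -, rfl⟩ w hw
    simpa using hw

lemma graded_list_prod_mem_wordSpan
    (hspan : ∀ g, ∀ v ∈ L.grading g, v ∈ Submodule.span K (b '' {i | d i = g})) (l : List (G × V))
    (hl : ∀ p ∈ l, p.2 ∈ L.grading p.1) : (l.map fun p => ι K p.2).prod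
      ∈ wordSpan b {w | w.length = l.length ∧ wordDeg d w = (l.map Prod.fst).prod} := by
  induction l with
  | nil => exact word_mem_wordSpan (b := b) (w := []) ⟨rfl, rfl⟩
  | cons p l ih =>
    rw [List.map_cons, List.prod_cons]
    refine mul_mem_wordSpan ?_ (mem_wordSpan_of_mem_grading hspan (hl p (by simp)))
      (ih fun q hq => hl q (by simp [hq]))
    rintro u ⟨hu, hu'⟩ w ⟨hw, hw'⟩
    refine ⟨by simp [hu, hw, add_comm], ?_⟩
    rw [← hu', ← hw']
    simp [wordDeg]

variable (b) in
lemma span_list_prod_eq_map (π : TensorAlgebra K V →ₐ[K] A) (p : ℕ → Prop) :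
    Submodule.span K {u | ∃ l : List V, p l.length ∧ u = (l.map fun v => π (ι K v)).prod}
      = (wordSpan b {w | p w.length}).map π.toLinearMap := by
  refine le_antisymm (Submodule.span_le.mpr ?_) ?_
  · rintro _ ⟨l, hl, rfl⟩
    refine ⟨(l.map (ι K)).prod, wordSpan_mono (fun w hw => ?_) (list_prod_mem_wordSpan l), ?_⟩
    · rw [Set.mem_ofPred_eq] at hw ⊢
      rwa [hw]
    · simp [map_list_prod, Function.comp_def]
  · rintro _ ⟨t, ht, rfl⟩
    refine map_wordSpan_le (f := π.toLinearMap) (fun w hw => ?_) ht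
    refine Submodule.subset_span ⟨w.map b, by simpa using hw, ?_⟩
    simp [word, map_list_prod, Function.comp_def]

lemma span_graded_list_prod_eq_map (hd : ∀ i, b i ∈ L.grading (d i))
    (hspan : ∀ g, ∀ v ∈ L.grading g, v ∈ Submodule.span K (b '' {i | d i = g}))
    (π : TensorAlgebra K V →ₐ[K] A) (p : ℕ → G → Prop) :
    Submodule.span K {u | ∃ l : List (G × V), (∀ q ∈ l, q.2 ∈ L.grading q.1) ∧
        p l.length (l.map Prod.fst).prod ∧ u = (l.map fun q => π (ι K q.2)).prod}
      = (wordSpan b {w | p w.length (wordDeg d w)}).map π.toLinearMap := by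
  refine le_antisymm (Submodule.span_le.mpr ?_) ?_
  · rintro _ ⟨l, hl, hp, rfl⟩
    refine ⟨(l.map fun q => ι K q.2).prod, wordSpan_mono (fun w hw => ?_)
      (graded_list_prod_mem_wordSpan hspan l hl), ?_⟩
    · rw [Set.mem_ofPred_eq] at hw ⊢
      rwa [hw.1, hw.2]
    · simp [map_list_prod, Function.comp_def]
  · rintro _ ⟨t, ht, rfl⟩
    refine map_wordSpan_le (f := π.toLinearMap) (fun w hw => ?_) ht
    refine Submodule.subset_span
      ⟨w.map fun i => (d i, b i), ?_, by simpa [wordDeg, Function.comp_def] using hw, ?_⟩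
    · simp only [List.mem_map, forall_exists_index, and_imp]
      rintro _ i - rfl
      exact hd i
    · simp [word, map_list_prod, Function.comp_def]

variable (b)

lemma Ufil_eq_map (L : ColorLieAlgebra χ V) (c : ColorCocycle L) (n : ℕ) :
    Ufil L c n = (tensorFil b n).map (toUenv L c).toLinearMap :=
  span_list_prod_eq_map b (toUenv L c) (· ≤ n)

lemma Ulow_eq_map (L : ColorLieAlgebra χ V) (c : ColorCocycle L) (n : ℕ) :
    Ulow L c n = (wordSpan b {w | w.length < n}).map (toUenv L c).toLinearMap := by
  cases n with
  | zero => simp [Ulow, wordSpan]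
  | succ n =>
    simp only [Nat.lt_succ_iff]
    exact Ufil_eq_map b L c n

lemma ESdeg_eq_map (L : ColorLieAlgebra χ V) (n : ℕ) :
    ESdeg χ L.grading n = (wordSpan b {w | w.length = n}).map (toEps L).toLinearMap :=
  span_list_prod_eq_map b (toEps L) (· = n)

variable {b} (hd : ∀ i, b i ∈ L.grading (d i))
  (hspan : ∀ g, ∀ v ∈ L.grading g, v ∈ Submodule.span K (b '' {i | d i = g}))

include hd hspan in
lemma Ugrading_eq_map (g : G) :
    Ugrading L c g = (wordSpan b {w | wordDeg d w = g}).map (toUenv L c).toLinearMap :=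
  span_graded_list_prod_eq_map hd hspan (toUenv L c) fun _ h => h = g

include hd hspan in
lemma ESdegG_eq_map (n : ℕ) (g : G) : ESdegG χ L.grading n g
    = (wordSpan b {w | w.length = n ∧ wordDeg d w = g}).map (toEps L).toLinearMap := by
  rw [← span_graded_list_prod_eq_map hd hspan (toEps L) fun m h => m = n ∧ h = g]
  simp only [and_assoc]
  rfl

lemma toUenv_relTerm {g h : G} {x y : V} (hx : x ∈ L.grading g) (hy : y ∈ L.grading h) :
    toUenv L c (relTerm L c g h x y) = 0 := by
  rw [relTerm_apply, sub_sub, map_sub, toUenv_ι_mul_ι c hx hy, sub_self]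

lemma toEps_swapTerm {g h : G} {x y : V} (hx : x ∈ L.grading g) (hy : y ∈ L.grading h) :
    toEps L (swapTerm χ g h x y) = 0 := by
  rw [swapTerm_apply, map_sub, toEps_ι_mul_ι hx hy, sub_self]

include hspan in
lemma map_eq_of_URel (f : TensorAlgebra K V →ₗ[K] M)
    (hf : ∀ u v i j, f (word b u * relTerm L c (d i) (d j) (b i) (b j) * word b v) = 0)
    (x y : TensorAlgebra K V) (hxy : URel L c x y) (U W : TensorAlgebra K V) :
    f (U * x * W) = f (U * y * W) := by
  obtain ⟨hx, hy⟩ := hxy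
  rename_i g h x y
  have key := map_mul_mul_eq_zero hspan (relTerm L c g h) (f := f) (P := Set.univ) (Q := Set.univ)
    (fun u _ v _ i hi j hj => by subst hi hj; exact hf u v i j)
    (U := U) (W := W) (by simp [wordSpan_univ]) (by simp [wordSpan_univ]) hx hy
  rw [relTerm_apply, sub_sub, mul_sub, sub_mul, map_sub, sub_eq_zero, tailTerm_apply,
    ← add_assoc] at key
  exact key

include hspan in
lemma exists_Uenv_lift (f : TensorAlgebra K V →ₗ[K] M)
    (hf : ∀ u v i j, f (word b u * relTerm L c (d i) (d j) (b i) (b j) * word b v) = 0) :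
    ∃ F : Uenv L c →ₗ[K] M, ∀ t, F (toUenv L c t) = f t :=
  exists_factorization (toUenv L c).toLinearMap (toUenv_surjective L c) f
    fun _ _ => map_eq_of_ringQuot_eq (URel L c) f (map_eq_of_URel hspan f hf)

include hspan in
lemma map_eq_of_SRel (f : TensorAlgebra K V →ₗ[K] M)
    (hf : ∀ u v i j, f (word b u * swapTerm χ (d i) (d j) (b i) (b j) * word b v) = 0)
    (x y : TensorAlgebra K V) (hxy : SRel χ L.grading x y) (U W : TensorAlgebra K V) :
    f (U * x * W) = f (U * y * W) := by
  obtain ⟨hx, hy⟩ := hxy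
  rename_i g h x y
  have key := map_mul_mul_eq_zero hspan (swapTerm χ g h) (f := f) (P := Set.univ) (Q := Set.univ)
    (fun u _ v _ i hi j hj => by subst hi hj; exact hf u v i j)
    (U := U) (W := W) (by simp [wordSpan_univ]) (by simp [wordSpan_univ]) hx hy
  rw [swapTerm_apply, mul_sub, sub_mul, map_sub, sub_eq_zero] at key
  exact key

include hspan in
lemma exists_EpsSymAlg_lift (f : TensorAlgebra K V →ₗ[K] M)
    (hf : ∀ u v i j, f (word b u * swapTerm χ (d i) (d j) (b i) (b j) * word b v) = 0) :
    ∃ F : EpsSymAlg χ L.grading →ₗ[K] M, ∀ t, F (toEps L t) = f t :=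
  exists_factorization (toEps L).toLinearMap (toEps_surjective L) f
    fun _ _ => map_eq_of_ringQuot_eq (SRel χ L.grading) f (map_eq_of_SRel hspan f hf)

omit [DecidableEq G] in
lemma word_mul_swapTerm_mul_word_mem (χ : ColorStructure G K) (g h : G) (u v : List I) (i j : I) :
    word b u * swapTerm χ g h (b i) (b j) * word b v
      ∈ wordSpan b {w | w.length = u.length + 2 + v.length} := by
  have h_word : ∀ i j, word b u * (ι K (b i) * ι K (b j)) * word b v
      ∈ wordSpan b {w | w.length = u.length + 2 + v.length} := fun i j => by
    rw [show word b u * (ι K (b i) * ι K (b j)) * word b v = word b (u ++ i :: j :: v) by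
      simp [mul_assoc]]
    exact word_mem_wordSpan (by simp; omega)
  rw [swapTerm_apply, mul_sub, sub_mul, mul_smul_comm, smul_mul_assoc]
  exact sub_mem (h_word i j) (Submodule.smul_mem _ _ (h_word j i))

include hd hspan in
lemma word_mul_relTerm_mul_word_mem (u v : List I) (i j : I) :
    word b u * relTerm L c (d i) (d j) (b i) (b j) * word b v
      ∈ wordSpan b {w | wordDeg d w = wordDeg d u * (d i * d j) * wordDeg d v} := by
  refine mul_mem_wordSpan (P := {w | wordDeg d w = wordDeg d u * (d i * d j)})
    (Q := {w | wordDeg d w = wordDeg d v}) ?_ (mul_mem_wordSpan (P := {w | wordDeg d w = wordDeg d u})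
      (Q := {w | wordDeg d w = d i * d j}) ?_ (word_mem_wordSpan rfl) ?_) (word_mem_wordSpan rfl)
  · intro _ h₁ _ h₂
    rw [Set.mem_ofPred_eq] at *
    rw [← h₁, ← h₂]
    simp [wordDeg]
  · intro _ h₁ _ h₂
    rw [Set.mem_ofPred_eq] at *
    rw [← h₁, ← h₂]
    simp [wordDeg]
  have h_word : ∀ i j, ι K (b i) * ι K (b j) = word b [i, j] := fun i j => by simp
  rw [relTerm_apply, tailTerm_apply, h_word, h_word]
  refine sub_mem (sub_mem (word_mem_wordSpan (by simp [wordDeg])) (Submodule.smul_mem _ _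
    (word_mem_wordSpan (by simp [wordDeg, mul_comm])))) (add_mem ?_ ?_)
  · exact wordSpan_mono (fun w hw => hw.2)
      (mem_wordSpan_of_mem_grading hspan (L.bracket_grade _ _ _ (hd i) _ (hd j)))
  · by_cases h : d i * d j = 1
    · rw [Algebra.algebraMap_eq_smul_one, h]
      exact Submodule.smul_mem _ _ (word_mem_wordSpan (b := b) (w := []) rfl)
    · rw [c.degree_zero _ _ h _ (hd i) _ (hd j), map_zero]
      exact zero_mem _

include hd hspan in
lemma exists_EpsSymAlg_proj (n : ℕ) :
    ∃ p : EpsSymAlg χ L.grading →ₗ[K] EpsSymAlg χ L.grading,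
      ∀ t, p (toEps L t) = toEps L (wordProj b {w | w.length = n} t) := by
  refine exists_EpsSymAlg_lift hspan ((toEps L).toLinearMap ∘ₗ wordProj b _) fun u v i j => ?_
  have h_mem := word_mul_swapTerm_mul_word_mem (b := b) χ (d i) (d j) u v i j
  by_cases hn : u.length + 2 + v.length = n
  · subst hn
    rw [LinearMap.comp_apply, wordProj_eq_self h_mem]
    simp [toEps_swapTerm (hd i) (hd j)]
  · rw [LinearMap.comp_apply, wordProj_eq_zero (fun w hw => ?_) h_mem, map_zero]
    rw [Set.mem_ofPred_eq] at *
    omega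

include hd hspan in
lemma exists_Uenv_proj (c : ColorCocycle L) (g : G) : ∃ p : Uenv L c →ₗ[K] Uenv L c,
    ∀ t, p (toUenv L c t) = toUenv L c (wordProj b {w | wordDeg d w = g} t) := by
  refine exists_Uenv_lift hspan ((toUenv L c).toLinearMap ∘ₗ wordProj b _) fun u v i j => ?_
  have h_mem := word_mul_relTerm_mul_word_mem (c := c) hd hspan u v i j
  by_cases hg : wordDeg d u * (d i * d j) * wordDeg d v = g
  · subst hg
    rw [LinearMap.comp_apply, wordProj_eq_self h_mem]
    simp [toUenv_relTerm (hd i) (hd j)]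
  · rw [LinearMap.comp_apply, wordProj_eq_zero (fun w hw => ?_) h_mem, map_zero]
    rw [Set.mem_ofPred_eq] at *
    rwa [hw]

include hd hspan in
/-- The canonical map from the `ε`-symmetric algebra to the associated graded algebra is
well defined. -/
lemma toUenv_mem_Ulow (c : ColorCocycle L) {n : ℕ} {t : TensorAlgebra K V}
    (ht : t ∈ wordSpan b {w | w.length = n}) (h0 : toEps L t = 0) :
    toUenv L c t ∈ Ulow L c n := by
  obtain ⟨F, hF⟩ := exists_EpsSymAlg_lift hspan
    ((Ulow L c n).mkQ ∘ₗ (toUenv L c).toLinearMap ∘ₗ wordProj b {w | w.length = n}) fun u v i j => by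
      have h_mem := word_mul_swapTerm_mul_word_mem (b := b) χ (d i) (d j) u v i j
      by_cases hn : u.length + 2 + v.length = n
      · subst hn
        rw [LinearMap.comp_apply, LinearMap.comp_apply, wordProj_eq_self h_mem,
          Submodule.mkQ_apply, Submodule.Quotient.mk_eq_zero, Ulow_eq_map b]
        refine ⟨word b u * tailTerm L c (b i) (b j) * word b v, ?_, ?_⟩
        · refine wordSpan_mono (fun w (hw : w.length ≤ u.length + 1 + v.length) => ?_)
            (mul_mem_tensorFil (mul_mem_tensorFil (word_mem_tensorFil (w := u) le_rfl)
              (tailTerm_mem_tensorFil L c (b i) (b j))) (word_mem_tensorFil (w := v) le_rfl))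
          rw [Set.mem_ofPred_eq]
          omega
        · have := toUenv_relTerm (c := c) (hd i) (hd j)
          rw [relTerm, LinearMap.sub_apply, LinearMap.sub_apply, map_sub, sub_eq_zero] at this
          simp [this]
      · rw [LinearMap.comp_apply, LinearMap.comp_apply, wordProj_eq_zero (fun w hw => ?_) h_mem,
          map_zero, map_zero]
        rw [Set.mem_ofPred_eq] at *
        omega
  have := hF t
  rwa [h0, map_zero, LinearMap.comp_apply, LinearMap.comp_apply, wordProj_eq_self ht, eq_comm,
    Submodule.mkQ_apply, Submodule.Quotient.mk_eq_zero] at this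

include hd hspan in
/-- The inverse of the canonical map, lifted to a linear map on `U_ω(L)`. -/
lemma exists_symbol [CharZero K] (c : ColorCocycle L) (n : ℕ) :
    ∃ ψ : Uenv L c →ₗ[K] EpsSymAlg χ L.grading, ∀ t ∈ tensorFil b n,
      ψ (toUenv L c t) = toEps L (wordProj b {w | w.length = n} t) := by
  obtain ⟨σ, hσ⟩ := exists_isStraightening L c hd hspan
  obtain ⟨F, hF⟩ := exists_Uenv_lift (c := c) hspan σ fun u v i j => (hσ _).map_rel u v i j le_rfl
  obtain ⟨p, hp⟩ := exists_EpsSymAlg_proj hd hspan n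
  have hp_low : ∀ k < n, ∀ s ∈ (tensorFil b k).map (toEps L).toLinearMap, p s = 0 := by
    rintro k hk _ ⟨t, ht, rfl⟩
    rw [AlgHom.toLinearMap_apply, hp, wordProj_eq_zero (fun w hw => ?_) ht, map_zero]
    rw [Set.mem_ofPred_eq] at *
    omega
  refine ⟨p ∘ₗ F, fun t ht => ?_⟩
  rw [LinearMap.comp_apply, hF]
  refine eq_of_eq_on_words (f := p ∘ₗ σ) (g := (toEps L).toLinearMap ∘ₗ wordProj b _)
    (fun w hw => ?_) ht
  have hw : w.length ≤ n := hw
  rw [LinearMap.comp_apply, LinearMap.comp_apply, AlgHom.toLinearMap_apply]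
  rcases hw.lt_or_eq with h | h
  · rw [hp_low _ h _ ((hσ n).map_mem hw (word_mem_tensorFil le_rfl)),
      wordProj_word_notMem (by rw [Set.mem_ofPred_eq]; omega), map_zero]
  · rw [← hp]
    cases n with
    | zero => rw [List.length_eq_zero_iff.mp h, word_nil, (hσ 0).apply_one, map_one (toEps L)]
    | succ n =>
      rw [← sub_eq_zero, ← map_sub]
      exact hp_low n (by omega) _ ((hσ (n + 1)).map_word n w le_rfl h)

lemma list_prod_Uι (L : ColorLieAlgebra χ V) (c : ColorCocycle L) (l : List V) :
    (l.map (Uι L c)).prod = toUenv L c (l.map (ι K)).prod := by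
  rw [map_list_prod, List.map_map]
  rfl

lemma list_prod_ESι (L : ColorLieAlgebra χ V) (l : List V) :
    (l.map (ESι χ L.grading)).prod = toEps L (l.map (ι K)).prod := by
  rw [map_list_prod, List.map_map]
  rfl

lemma wordSpan_le_tensorFil {n : ℕ} {P : Set (List I)} (h : ∀ w ∈ P, w.length ≤ n) :
    wordSpan b P ≤ tensorFil b n :=
  wordSpan_mono h

lemma wordProj_mem {P Q : Set (List I)} {t : TensorAlgebra K V} (ht : t ∈ wordSpan b P) :
    wordProj b Q t ∈ wordSpan b {w | w ∈ P ∧ w ∈ Q} := by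
  refine map_wordSpan_le (fun w hw => ?_) ht
  by_cases hQ : w ∈ Q
  · rw [wordProj_word_mem hQ]
    exact word_mem_wordSpan ⟨hw, hQ⟩
  · rw [wordProj_word_notMem hQ]
    exact zero_mem _

lemma sub_wordProj_mem {P Q : Set (List I)} {t : TensorAlgebra K V} (ht : t ∈ wordSpan b P) :
    t - wordProj b Q t ∈ wordSpan b {w | w ∈ P ∧ w ∉ Q} := by
  refine map_wordSpan_le (f := LinearMap.id - wordProj b Q) (fun w hw => ?_) ht
  rw [LinearMap.sub_apply, LinearMap.id_apply]
  by_cases hQ : w ∈ Q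
  · rw [wordProj_word_mem hQ, sub_self]
    exact zero_mem _
  · rw [wordProj_word_notMem hQ, sub_zero]
    exact word_mem_wordSpan ⟨hw, hQ⟩

section Symbol

variable {n : ℕ} {ψ : Uenv L c →ₗ[K] EpsSymAlg χ L.grading}
  (hψ : ∀ t ∈ tensorFil b n, ψ (toUenv L c t) = toEps L (wordProj b {w | w.length = n} t))
include hψ

lemma symbol_mem {u : Uenv L c} (hu : u ∈ Ufil L c n) : ψ u ∈ ESdeg χ L.grading n := by
  rw [Ufil_eq_map b] at hu
  obtain ⟨t, ht, rfl⟩ := hu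
  rw [AlgHom.toLinearMap_apply, hψ t ht, ESdeg_eq_map b]
  exact ⟨_, wordSpan_mono (fun w hw => hw.2) (wordProj_mem ht), rfl⟩

lemma symbol_toUenv {t : TensorAlgebra K V} (ht : t ∈ wordSpan b {w | w.length = n}) :
    ψ (toUenv L c t) = toEps L t := by
  rw [hψ t (wordSpan_le_tensorFil (fun w hw => hw.le) ht), wordProj_eq_self ht]

include hd hspan in
lemma mem_Ulow_of_symbol_eq_zero {u : Uenv L c} (hu : u ∈ Ufil L c n) (h0 : ψ u = 0) :
    u ∈ Ulow L c n := by
  rw [Ufil_eq_map b] at hu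
  obtain ⟨t, ht, rfl⟩ := hu
  rw [AlgHom.toLinearMap_apply, hψ t ht] at h0
  have h_sub : t - wordProj b {w | w.length = n} t ∈ wordSpan b {w | w.length < n} := by
    refine wordSpan_mono ?_ (sub_wordProj_mem (P := {w | w.length ≤ n}) ht)
    rintro w ⟨hle, hne⟩
    exact Nat.lt_of_le_of_ne hle hne
  have h_low : toUenv L c (t - wordProj b {w | w.length = n} t) ∈ Ulow L c n := by
    rw [Ulow_eq_map b]
    exact Submodule.mem_map_of_mem h_sub
  have h_proj : wordProj b {w | w.length = n} t ∈ wordSpan b {w | w.length = n} :=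
    wordSpan_mono (fun w hw => hw.2) (wordProj_mem ht)
  rw [map_sub (toUenv L c)] at h_low
  exact (Submodule.sub_mem_iff_left _ (toUenv_mem_Ulow hd hspan c h_proj h0)).mp h_low

lemma symbol_eq_zero_of_mem_Ulow {u : Uenv L c} (hu : u ∈ Ulow L c n) : ψ u = 0 := by
  rw [Ulow_eq_map b] at hu
  obtain ⟨t, ht, rfl⟩ := hu
  have ht' : t ∈ tensorFil b n := wordSpan_mono (fun w (hw : w.length < n) => hw.le) ht
  rw [AlgHom.toLinearMap_apply, hψ t ht',
    wordProj_eq_zero (P := {w | w.length = n}) (fun w (hw : w.length < n) => hw.ne) ht, map_zero]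

include hd hspan in
/-- The symbol map induces an isomorphism from the `n`-th graded piece of `U_ω(L)` to `S^n(L)`. -/
lemma exists_symbolEquiv :
    ∃ e : (↥(Ufil L c n) ⧸ Submodule.comap (Ufil L c n).subtype (Ulow L c n))
        ≃ₗ[K] ↥(ESdeg χ L.grading n),
      ∀ u : ↥(Ufil L c n), (e (Submodule.mkQ _ u) : EpsSymAlg χ L.grading) = ψ u := by
  let Ψ : ↥(Ufil L c n) →ₗ[K] ↥(ESdeg χ L.grading n) :=
    (ψ ∘ₗ (Ufil L c n).subtype).codRestrict _ fun u => symbol_mem hψ u.2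
  have hsurj : Function.Surjective Ψ := by
    rintro ⟨s, hs⟩
    obtain ⟨t, ht, rfl⟩ := (ESdeg_eq_map b L n).le hs
    have hu : toUenv L c t ∈ Ufil L c n := by
      rw [Ufil_eq_map b]
      exact ⟨t, wordSpan_le_tensorFil (fun w hw => hw.le) ht, rfl⟩
    exact ⟨⟨toUenv L c t, hu⟩, Subtype.ext (symbol_toUenv hψ ht)⟩
  have hker : Submodule.comap (Ufil L c n).subtype (Ulow L c n) = LinearMap.ker Ψ := by
    ext u
    rw [Submodule.mem_comap, LinearMap.mem_ker, ← Subtype.val_inj]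
    exact ⟨symbol_eq_zero_of_mem_Ulow hψ, mem_Ulow_of_symbol_eq_zero hd hspan hψ u.2⟩
  exact ⟨(Submodule.quotEquivOfEq _ _ hker).trans (Ψ.quotKerEquivOfSurjective hsurj),
    fun u => rfl⟩

include hd hspan in
lemma symbol_mem_ESdegG {g : G} {u : Uenv L c} (hu : u ∈ Ufil L c n) (hg : u ∈ Ugrading L c g) :
    ψ u ∈ ESdegG χ L.grading n g := by
  obtain ⟨p, hp⟩ := exists_Uenv_proj hd hspan c g
  have hpu : p u = u := by
    rw [Ugrading_eq_map hd hspan] at hg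
    obtain ⟨t, ht, rfl⟩ := hg
    rw [AlgHom.toLinearMap_apply, hp, wordProj_eq_self ht]
  rw [Ufil_eq_map b] at hu
  obtain ⟨t, ht, rfl⟩ := hu
  rw [AlgHom.toLinearMap_apply, hp] at hpu
  have hgt := wordProj_mem (Q := {w | wordDeg d w = g}) ht
  rw [AlgHom.toLinearMap_apply, ← hpu, hψ _ (wordSpan_le_tensorFil (fun w hw => hw.1) hgt),
    ESdegG_eq_map hd hspan]
  exact Submodule.mem_map_of_mem (wordSpan_mono (Q := {w | w.length = n ∧ wordDeg d w = g})
    (fun w hw => ⟨hw.2, hw.1.2⟩) (wordProj_mem hgt))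

end Symbol

end Comparison

end ColorPBW

/-- the canonical homomorphism `φ_ω : S(L) → G_ω(L)` from the `ε`-symmetric
algebra to the associated graded algebra of `U_ω(L)` is an isomorphism of `(ℤ×G)`-graded
algebras: for each `n` it induces a linear equivalence of the degree-`n` component
`S^n(L)` with `U_{n,ω}(L)/U_{n-1,ω}(L)` sending (the class of) each monomial
`x₁ ⋯ xₙ` computed in `S(L)` to the class of the same monomial computed in `U_ω(L)`,
and it respects the `G`-gradings. -/
theorem symbol_map_isomorphism [CharZero K]
    (L : ColorLieAlgebra χ V) (c : ColorCocycle L) :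
    ∃ Φ : ∀ n : ℕ, ↥(ESdeg χ L.grading n) ≃ₗ[K]
        (↥(Ufil L c n) ⧸ Submodule.comap (Ufil L c n).subtype (Ulow L c n)),
      (∀ (n : ℕ) (l : List V) (_ : l.length = n)
          (h1 : (l.map (ESι χ L.grading)).prod ∈ ESdeg χ L.grading n)
          (h2 : (l.map (Uι L c)).prod ∈ Ufil L c n),
        Φ n ⟨(l.map (ESι χ L.grading)).prod, h1⟩
          = Submodule.mkQ _ ⟨(l.map (Uι L c)).prod, h2⟩) ∧
      (∀ (n : ℕ) (g : G),
        Submodule.map (Φ n).toLinearMap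
            (Submodule.comap (ESdeg χ L.grading n).subtype (ESdegG χ L.grading n g))
          = Submodule.map
              (Submodule.mkQ (Submodule.comap (Ufil L c n).subtype (Ulow L c n)))
              (Submodule.comap (Ufil L c n).subtype (Ugrading L c g))) := by
  obtain ⟨b, hd, hspan⟩ := ColorPBW.exists_homogeneous_basis L
  choose ψ hψ using ColorPBW.exists_symbol hd hspan c
  choose e he using fun n => ColorPBW.exists_symbolEquiv hd hspan (hψ n)
  have h_symm : ∀ (n : ℕ) (t : TensorAlgebra K V), t ∈ ColorPBW.wordSpan b {w | w.length = n} →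
      ∀ (h₁ : ColorPBW.toEps L t ∈ ESdeg χ L.grading n)
        (h₂ : ColorPBW.toUenv L c t ∈ Ufil L c n),
      (e n).symm ⟨ColorPBW.toEps L t, h₁⟩ = Submodule.mkQ _ ⟨ColorPBW.toUenv L c t, h₂⟩ := by
    intro n t ht h₁ h₂
    rw [LinearEquiv.symm_apply_eq]
    exact Subtype.ext ((he n _).trans (ColorPBW.symbol_toUenv (hψ n) ht)).symm
  refine ⟨fun n => (e n).symm, ?_, fun n g => le_antisymm ?_ ?_⟩
  · rintro n l rfl h₁ h₂
    simp only [ColorPBW.list_prod_Uι, ColorPBW.list_prod_ESι] at h₁ h₂ ⊢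
    exact h_symm _ _ (ColorPBW.list_prod_mem_wordSpan l) h₁ h₂
  · rintro _ ⟨⟨s, hs⟩, hsg, rfl⟩
    obtain ⟨t, ht, rfl⟩ := (ColorPBW.ESdegG_eq_map hd hspan n g).le hsg
    have h₂ : ColorPBW.toUenv L c t ∈ Ufil L c n := by
      rw [ColorPBW.Ufil_eq_map b]
      exact ⟨t, ColorPBW.wordSpan_le_tensorFil (fun w hw => hw.1.le) ht, rfl⟩
    refine ⟨⟨_, h₂⟩, ?_,
      (h_symm n t (ColorPBW.wordSpan_mono (fun w hw => hw.1) ht) hs h₂).symm⟩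
    change ColorPBW.toUenv L c t ∈ Ugrading L c g
    rw [ColorPBW.Ugrading_eq_map hd hspan]
    exact ⟨t, ColorPBW.wordSpan_mono (fun w hw => hw.2) ht, rfl⟩
  · rintro _ ⟨u, hug, rfl⟩
    refine ⟨e n (Submodule.mkQ _ u), ?_, (e n).symm_apply_apply _⟩
    change (e n (Submodule.mkQ _ u) : EpsSymAlg χ L.grading) ∈ ESdegG χ L.grading n g
    rw [he]
    exact ColorPBW.symbol_mem_ESdegG hd hspan (hψ n) u.2 hug
end

section
/- Let L be a finite-dimensional color Lie algebra over K and ω a scalar graded 2-cocycle. Then the generalized enveloping algebra U_ω(L) is left and right Noetherian. -/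
open TensorAlgebra

variable {G K V : Type*} [CommGroup G] [DecidableEq G] [Field K] [AddCommGroup V] [Module K V]
  {χ : ColorStructure G K}

instance UpperSet.wellFoundedLT_of_wellQuasiOrderedLE {α : Type*} [Preorder α]
    [WellQuasiOrderedLE α] : WellFoundedLT (UpperSet α) := by
  refine ⟨wellFounded_iff_isEmpty_descending_chain.2 ⟨fun ⟨f, hf⟩ => ?_⟩⟩
  have hanti : Antitone f := antitone_nat_of_succ_le fun n => (hf n).le
  have hex : ∀ n, ∃ a ∈ f (n + 1), a ∉ f n := fun n =>
    Set.exists_of_ssubset (UpperSet.coe_ssubset_coe.2 (hf n))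
  choose a ha ha' using hex
  obtain ⟨i, j, hij, hle⟩ := wellQuasiOrdered_le a
  exact ha' j ((f j).upper hle (hanti (Nat.succ_le_of_lt hij) (ha i)))

section LeadingTerms

open scoped MonomialOrder

variable {F A σ : Type*} [Field F] [Ring A] [Algebra F A]

/-- The span of the elements `m b` with `b` smaller than `a`. -/
def spanBelow (mo : MonomialOrder σ) (m : (σ →₀ ℕ) → A) (a : σ →₀ ℕ) : Submodule F A :=
  Submodule.span F (m '' {b | b ≺[mo] a})

lemma spanBelow_mono (mo : MonomialOrder σ) (m : (σ →₀ ℕ) → A) {a b : σ →₀ ℕ}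
    (h : a ≼[mo] b) : spanBelow (F := F) mo m a ≤ spanBelow mo m b :=
  Submodule.span_mono (Set.image_mono fun _ hc => lt_of_lt_of_le hc h)

lemma mul_mem_spanBelow {mo : MonomialOrder σ} {m : (σ →₀ ℕ) → A} {x : σ → A}
    (hx : ∀ i a, ∃ q : F, q ≠ 0 ∧
      x i * m a - q • m (a + Finsupp.single i 1) ∈ spanBelow (F := F) mo m (a + .single i 1))
    (i : σ) {a : σ →₀ ℕ} {u : A} (hu : u ∈ spanBelow (F := F) mo m a) :
    x i * u ∈ spanBelow (F := F) mo m (a + .single i 1) := by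
  induction hu using Submodule.span_induction with
  | mem u hu =>
    obtain ⟨b, hb, rfl⟩ := hu
    have hlt : b + Finsupp.single i 1 ≺[mo] a + Finsupp.single i 1 := by
      rw [map_add, map_add, add_lt_add_iff_right]
      exact hb
    obtain ⟨q, -, hq⟩ := hx i b
    have h := add_mem (spanBelow_mono mo m hlt.le hq)
      (Submodule.smul_mem _ q (Submodule.subset_span ⟨_, hlt, rfl⟩))
    rwa [sub_add_cancel] at h
  | zero => simp
  | add u v _ _ hu hv => rw [mul_add]; exact add_mem hu hv
  | smul c u _ hu => rw [mul_smul_comm]; exact Submodule.smul_mem _ c hu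

/-- The exponents of leading terms of elements of a left ideal. -/
def leadingExponents {mo : MonomialOrder σ} {m : (σ →₀ ℕ) → A} {x : σ → A}
    (hx : ∀ i a, ∃ q : F, q ≠ 0 ∧
      x i * m a - q • m (a + Finsupp.single i 1) ∈ spanBelow (F := F) mo m (a + .single i 1))
    (I : Ideal A) : UpperSet (σ →₀ ℕ) where
  carrier := {a | ∃ u ∈ I, u - m a ∈ spanBelow (F := F) mo m a}
  upper' := by
    intro a b hab ha
    obtain ⟨d, rfl⟩ := exists_add_of_le hab
    clear hab
    induction d using Finsupp.induction_linear generalizing a with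
    | zero => simpa using ha
    | add d e hd he => rw [← add_assoc]; exact he (hd ha)
    | single i n =>
      induction n with
      | zero => simpa using ha
      | succ n ih =>
        obtain ⟨u, hu, hua⟩ := ih
        rw [Finsupp.single_add, ← add_assoc]
        set b := a + Finsupp.single i n
        obtain ⟨q, hq0, hq⟩ := hx i b
        refine ⟨q⁻¹ • (x i * u), ?_, ?_⟩
        · rw [← smul_mul_assoc]
          exact I.mul_mem_left _ hu
        · have h := Submodule.smul_mem _ q⁻¹ (add_mem (mul_mem_spanBelow hx i hua) hq)
          rwa [mul_sub, sub_add_sub_cancel, smul_sub, inv_smul_smul₀ hq0] at h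

lemma exists_sub_smul_mem_spanBelow (mo : MonomialOrder σ) (m : (σ →₀ ℕ) → A)
    {a : σ →₀ ℕ} {u : A} (hu : u ∈ Submodule.span F (m '' {b | b ≼[mo] a})) :
    ∃ c : F, u - c • m a ∈ spanBelow (F := F) mo m a := by
  have hset : {b | b ≼[mo] a} = insert a {b | b ≺[mo] a} := by
    ext b
    simp [le_iff_eq_or_lt]
  rw [hset, Set.image_insert_eq, Submodule.mem_span_insert] at hu
  obtain ⟨c, v, hv, rfl⟩ := hu
  exact ⟨c, by simpa [spanBelow] using hv⟩

lemma eq_zero_or_exists_mem_span_le (mo : MonomialOrder σ) (m : (σ →₀ ℕ) → A)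
    {s : Set (σ →₀ ℕ)} {u : A} (hu : u ∈ Submodule.span F (m '' s)) :
    u = 0 ∨ ∃ b ∈ s, u ∈ Submodule.span F (m '' {d | d ≼[mo] b}) := by
  induction hu using Submodule.span_induction with
  | mem u hu =>
    obtain ⟨b, hb, rfl⟩ := hu
    exact .inr ⟨b, hb, Submodule.subset_span ⟨b, le_rfl, rfl⟩⟩
  | zero => exact .inl rfl
  | add u v _ _ hu hv =>
    have hmono : ∀ {b c : σ →₀ ℕ}, b ≼[mo] c →
        Submodule.span F (m '' {d | d ≼[mo] b}) ≤ Submodule.span F (m '' {d | d ≼[mo] c}) :=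
      fun h => Submodule.span_mono (Set.image_mono fun _ hd => le_trans hd h)
    rcases hu with rfl | ⟨b, hb, hu⟩
    · simpa using hv
    rcases hv with rfl | ⟨c, hc, hv⟩
    · exact .inr ⟨b, hb, by simpa using hu⟩
    rcases le_total (mo.toSyn b) (mo.toSyn c) with h | h
    · exact .inr ⟨c, hc, add_mem (hmono h hu) hv⟩
    · exact .inr ⟨b, hb, add_mem hu (hmono h hv)⟩
  | smul c u _ hu =>
    rcases hu with rfl | ⟨b, hb, hu⟩
    · exact .inl (smul_zero c)
    · exact .inr ⟨b, hb, Submodule.smul_mem _ c hu⟩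

lemma leadingExponents_strictAnti {mo : MonomialOrder σ} {m : (σ →₀ ℕ) → A} {x : σ → A}
    (hspan : Submodule.span F (Set.range m) = ⊤)
    (hx : ∀ i a, ∃ q : F, q ≠ 0 ∧
      x i * m a - q • m (a + Finsupp.single i 1) ∈ spanBelow (F := F) mo m (a + .single i 1)) :
    StrictAnti (leadingExponents hx) := by
  intro I J hIJ
  have hle : leadingExponents hx J ≤ leadingExponents hx I :=
    fun a ⟨u, hu, h⟩ => ⟨u, hIJ.le hu, h⟩
  refine lt_of_le_not_ge hle fun hge => hIJ.not_ge fun u huJ => ?_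
  have key : ∀ (s : mo.syn) (a : σ →₀ ℕ), mo.toSyn a = s →
      ∀ u ∈ J, u ∈ Submodule.span F (m '' {b | b ≼[mo] a}) → u ∈ I := by
    intro s
    induction s using WellFoundedLT.induction with
    | ind s ih =>
      rintro a rfl u huJ hu
      have below : ∀ v ∈ J, v ∈ spanBelow (F := F) mo m a → v ∈ I := by
        intro v hvJ hv
        rcases eq_zero_or_exists_mem_span_le mo m hv with rfl | ⟨b, hb, hv⟩
        · exact I.zero_mem
        · exact ih _ hb b rfl v hvJ hv
      obtain ⟨c, hc⟩ := exists_sub_smul_mem_spanBelow mo m hu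
      rcases eq_or_ne c 0 with rfl | hc0
      · exact below u huJ (by simpa using hc)
      have ha : a ∈ leadingExponents hx J := by
        refine ⟨c⁻¹ • u, ?_, ?_⟩
        · rw [← one_mul u, ← smul_mul_assoc]
          exact J.mul_mem_left _ huJ
        · have h := Submodule.smul_mem _ c⁻¹ hc
          rwa [smul_sub, inv_smul_smul₀ hc0] at h
      obtain ⟨w, hwI, hw⟩ := hge ha
      have hcw : c • w ∈ I := by
        rw [← one_mul w, ← smul_mul_assoc]
        exact I.mul_mem_left _ hwI
      have h : u - c • w ∈ I := by
        refine below _ (J.sub_mem huJ (hIJ.le hcw)) ?_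
        have h := sub_mem hc (Submodule.smul_mem _ c hw)
        rwa [smul_sub, sub_sub_sub_cancel_right] at h
      simpa using I.add_mem h hcw
  have hu : u ∈ Submodule.span F (m '' Set.univ) := by
    rw [Set.image_univ, hspan]
    trivial
  rcases eq_zero_or_exists_mem_span_le mo m hu with rfl | ⟨b, -, hv⟩
  · exact I.zero_mem
  · exact key _ b rfl u huJ hv

/-- An algebra spanned by monomials whose leading terms multiply up to nonzero scalars is left
Noetherian. -/
theorem isNoetherianRing_of_monomials [Finite σ] {mo : MonomialOrder σ} {m : (σ →₀ ℕ) → A}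
    {x : σ → A} (hspan : Submodule.span F (Set.range m) = ⊤)
    (hx : ∀ i a, ∃ q : F, q ≠ 0 ∧
      x i * m a - q • m (a + Finsupp.single i 1) ∈ spanBelow (F := F) mo m (a + .single i 1)) :
    IsNoetherianRing A :=
  isNoetherian_iff'.2 (leadingExponents_strictAnti hspan hx).wellFoundedGT

end LeadingTerms

section Words

variable {F A σ : Type*} [Field F] [Ring A] [Algebra F A]

/-- The span of the products of fewer than `n` of the elements `x i`. -/
def wordSpan (F : Type*) [Field F] [Algebra F A] (x : σ → A) (n : ℕ) : Submodule F A :=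
  Submodule.span F {u | ∃ l : List σ, l.length < n ∧ (l.map x).prod = u}

lemma prod_mem_wordSpan (x : σ → A) {l : List σ} {n : ℕ} (h : l.length < n) :
    (l.map x).prod ∈ wordSpan F x n :=
  Submodule.subset_span ⟨l, h, rfl⟩

lemma wordSpan_mono (x : σ → A) : Monotone (wordSpan F x) := fun _ _ h =>
  Submodule.span_mono fun _ ⟨l, hl, hu⟩ => ⟨l, hl.trans_le h, hu⟩

lemma mul_prod_mem_wordSpan (x : σ → A) {n : ℕ} {u : A} (hu : u ∈ wordSpan F x n) (l : List σ) :
    u * (l.map x).prod ∈ wordSpan F x (n + l.length) := by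
  induction hu using Submodule.span_induction with
  | mem u hu =>
    obtain ⟨k, hk, rfl⟩ := hu
    rw [← List.prod_append, ← List.map_append]
    exact prod_mem_wordSpan x (by simpa using hk)
  | zero => simp
  | add u v _ _ hu hv => rw [add_mul]; exact add_mem hu hv
  | smul c u _ hu => rw [smul_mul_assoc]; exact Submodule.smul_mem _ c hu

lemma mul_mem_wordSpan (x : σ → A) (i : σ) {n : ℕ} {u : A} (hu : u ∈ wordSpan F x n) :
    x i * u ∈ wordSpan F x (n + 1) := by
  induction hu using Submodule.span_induction with
  | mem u hu =>
    obtain ⟨k, hk, rfl⟩ := hu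
    rw [← List.prod_cons, ← List.map_cons]
    exact prod_mem_wordSpan x (by simpa using hk)
  | zero => simp
  | add u v _ _ hu hv => rw [mul_add]; exact add_mem hu hv
  | smul c u _ hu => rw [mul_smul_comm]; exact Submodule.smul_mem _ c hu

lemma exists_prod_sub_smul_mem_wordSpan {x : σ → A}
    (hx : ∀ i j, ∃ q : F, q ≠ 0 ∧ x i * x j - q • (x j * x i) ∈ wordSpan F x 2)
    {l k : List σ} (h : l.Perm k) :
    ∃ q : F, q ≠ 0 ∧ (l.map x).prod - q • (k.map x).prod ∈ wordSpan F x l.length := by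
  induction h with
  | nil => exact ⟨1, one_ne_zero, by simp⟩
  | cons i h ih =>
    obtain ⟨q, hq0, hq⟩ := ih
    refine ⟨q, hq0, ?_⟩
    simpa [mul_sub] using mul_mem_wordSpan x i hq
  | swap i j l =>
    obtain ⟨q, hq0, hq⟩ := hx j i
    refine ⟨q, hq0, ?_⟩
    have h := mul_prod_mem_wordSpan x hq l
    rw [add_comm] at h
    simpa [sub_mul, mul_assoc] using h
  | trans h₁ h₂ ih₁ ih₂ =>
    obtain ⟨q, hq0, hq⟩ := ih₁
    obtain ⟨r, hr0, hr⟩ := ih₂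
    refine ⟨q * r, mul_ne_zero hq0 hr0, ?_⟩
    rw [← h₁.length_eq] at hr
    have h := add_mem hq (Submodule.smul_mem _ q hr)
    rwa [smul_sub, smul_smul, sub_add_sub_cancel] at h

lemma card_toMultiset_eq_degree (a : σ →₀ ℕ) : (Finsupp.toMultiset a).card = a.degree :=
  Finsupp.card_toMultiset a

/-- The product of the `x i` with multiplicities given by `a`, in an unspecified order. -/
noncomputable def monomialProd (x : σ → A) (a : σ →₀ ℕ) : A :=
  ((Finsupp.toMultiset a).toList.map x).prod

lemma exists_prod_sub_smul_monomialProd_mem_wordSpan {x : σ → A}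
    (hx : ∀ i j, ∃ q : F, q ≠ 0 ∧ x i * x j - q • (x j * x i) ∈ wordSpan F x 2)
    {l : List σ} {a : σ →₀ ℕ} (h : Finsupp.toMultiset a = l) :
    ∃ q : F, q ≠ 0 ∧ (l.map x).prod - q • monomialProd x a ∈ wordSpan F x l.length :=
  exists_prod_sub_smul_mem_wordSpan hx <| Multiset.coe_eq_coe.1 <| by
    rw [Multiset.coe_toList, h]

lemma wordSpan_le_span_monomialProd {x : σ → A}
    (hx : ∀ i j, ∃ q : F, q ≠ 0 ∧ x i * x j - q • (x j * x i) ∈ wordSpan F x 2) (n : ℕ) :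
    wordSpan F x n ≤ Submodule.span F (monomialProd x '' {a | a.degree < n}) := by
  classical
  induction n with
  | zero => exact Submodule.span_le.2 fun u ⟨l, hl, _⟩ => absurd hl (Nat.not_lt_zero _)
  | succ n ih =>
    refine Submodule.span_le.2 ?_
    rintro _ ⟨l, hl, rfl⟩
    have ha : Finsupp.toMultiset (Multiset.toFinsupp (l : Multiset σ)) = l :=
      Multiset.toFinsupp_toMultiset _
    obtain ⟨q, -, hq⟩ := exists_prod_sub_smul_monomialProd_mem_wordSpan hx ha
    have hdeg : (Multiset.toFinsupp (l : Multiset σ)).degree < n + 1 := by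
      rw [← card_toMultiset_eq_degree, ha]
      exact hl
    have h := (wordSpan_mono x (Nat.lt_succ_iff.1 hl)).trans ih hq
    have h' := add_mem (Submodule.span_mono (Set.image_mono fun a ha => Nat.lt_succ_of_lt ha) h)
      (Submodule.smul_mem _ q (Submodule.subset_span ⟨_, hdeg, rfl⟩))
    rwa [sub_add_cancel] at h'

/-- A finitely generated algebra whose generators commute up to nonzero scalars and terms of
degree at most one is left Noetherian. -/
theorem isNoetherianRing_of_quasiCommuting {n : ℕ} {x : Fin n → A}
    (hgen : Algebra.adjoin F (Set.range x) = ⊤)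
    (hx : ∀ i j, ∃ q : F, q ≠ 0 ∧ x i * x j - q • (x j * x i) ∈ wordSpan F x 2) :
    IsNoetherianRing A := by
  refine isNoetherianRing_of_monomials (F := F) (mo := MonomialOrder.degLex)
    (m := monomialProd x) (x := x) ?_ fun i a => ?_
  · rw [eq_top_iff, ← Algebra.top_toSubmodule, ← hgen, Algebra.adjoin_eq_span, Submodule.span_le]
    intro u hu
    obtain ⟨l, hl, rfl⟩ := Submonoid.exists_list_of_mem_closure hu
    obtain ⟨k, rfl⟩ : ∃ k : List (Fin n), k.map x = l :=
      Set.mem_range.1 (by rw [Set.range_list_map]; exact hl)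
    exact Submodule.span_mono (Set.image_subset_range _ _)
      (wordSpan_le_span_monomialProd hx _ (prod_mem_wordSpan x (Nat.lt_succ_self _)))
  · have hperm : Finsupp.toMultiset (a + Finsupp.single i 1) =
        (i :: (Finsupp.toMultiset a).toList : List (Fin n)) := by
      rw [map_add, Finsupp.toMultiset_single, one_smul, ← Multiset.cons_coe,
        Multiset.coe_toList, add_comm, Multiset.singleton_add]
    obtain ⟨q, hq0, hq⟩ := exists_prod_sub_smul_monomialProd_mem_wordSpan hx hperm
    refine ⟨q, hq0, ?_⟩
    rw [List.map_cons, List.prod_cons] at hq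
    refine Submodule.span_mono (Set.image_mono fun b hb => ?_)
      (wordSpan_le_span_monomialProd hx _ hq)
    rw [Set.mem_ofPred_eq, List.length_cons, Multiset.length_toList,
      card_toMultiset_eq_degree] at hb
    refine MonomialOrder.degLex_lt_iff.2 (Finsupp.DegLex.lt_iff.2 (.inl ?_))
    simpa using hb

lemma op_mem_wordSpan (x : σ → A) {n : ℕ} {u : A} (hu : u ∈ wordSpan F x n) :
    MulOpposite.op u ∈ wordSpan F (fun i => MulOpposite.op (x i)) n := by
  induction hu using Submodule.span_induction with
  | mem u hu =>
    obtain ⟨l, hl, rfl⟩ := hu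
    refine Submodule.subset_span ⟨l.reverse, by simpa using hl, ?_⟩
    rw [MulOpposite.op_list_prod, List.map_map, List.map_reverse]
    rfl
  | zero => simp
  | add u v _ _ hu hv => exact add_mem hu hv
  | smul c u _ hu => exact Submodule.smul_mem _ c hu

theorem isNoetherianRing_op_of_quasiCommuting {n : ℕ} {x : Fin n → A}
    (hgen : Algebra.adjoin F (Set.range x) = ⊤)
    (hx : ∀ i j, ∃ q : F, q ≠ 0 ∧ x i * x j - q • (x j * x i) ∈ wordSpan F x 2) :
    IsNoetherianRing Aᵐᵒᵖ := by
  refine isNoetherianRing_of_quasiCommuting (F := F) (x := fun i => MulOpposite.op (x i)) ?_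
    fun i j => ?_
  · have h := Subalgebra.op_adjoin (R := F) (Set.range x)
    rw [hgen, Subalgebra.op_top] at h
    rw [h]
    congr 1
    ext u
    simp [← MulOpposite.unop_inj]
  · obtain ⟨q, hq0, hq⟩ := hx j i
    exact ⟨q, hq0, op_mem_wordSpan x hq⟩

end Words

lemma ColorLieAlgebra.exists_homogeneous_span [FiniteDimensional K V] (L : ColorLieAlgebra χ V) :
    ∃ (n : ℕ) (d : Fin n → G) (v : Fin n → V), (∀ i, v i ∈ L.grading (d i)) ∧
      Submodule.span K (Set.range v) = ⊤ := by
  let b := L.decomp.collectedBasis fun g => Module.Free.chooseBasis K (L.grading g)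
  have := Module.Finite.finite_basis b
  let e := (Finite.equivFin (Σ g, Module.Free.ChooseBasisIndex K (L.grading g))).symm
  refine ⟨_, fun i => (e i).1, fun i => b (e i), fun i => L.decomp.collectedBasis_mem _ _, ?_⟩
  have h : Set.range (fun i => b (e i)) = Set.range b := e.surjective.range_comp b
  rw [h, b.span_eq]

lemma Uι_mul (L : ColorLieAlgebra χ V) (c : ColorCocycle L) {g h : G} {a b : V}
    (ha : a ∈ L.grading g) (hb : b ∈ L.grading h) :
    Uι L c a * Uι L c b = χ.ε g h • (Uι L c b * Uι L c a) + Uι L c (L.bracket a b)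
      + algebraMap K (Uenv L c) (c.ω a b) := by
  have h := RingQuot.mkAlgHom_rel K (URel.rel (L := L) (c := c) ha hb)
  simp only [map_add, map_mul, map_smul, AlgHom.commutes] at h
  exact h

lemma adjoin_range_Uι (L : ColorLieAlgebra χ V) (c : ColorCocycle L) :
    Algebra.adjoin K (Set.range (Uι L c)) = ⊤ := by
  let f : TensorAlgebra K V →ₐ[K] Uenv L c := RingQuot.mkAlgHom K (URel L c)
  have hf : Function.Surjective f := RingQuot.mkAlgHom_surjective K (URel L c)
  have hr : Set.range (Uι L c) = f '' Set.range (ι K) := Set.range_comp f (ι K)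
  rw [hr, ← AlgHom.map_adjoin, TensorAlgebra.adjoin_range_ι, Algebra.map_top,
    AlgHom.range_eq_top]
  exact hf

/-- if `L` is a finite-dimensional color Lie algebra and `ω` a scalar graded
2-cocycle, then the generalized enveloping algebra `U_ω(L)` is left and right Noetherian. -/
theorem Uomega_noetherian [CharZero K] [FiniteDimensional K V]
    (L : ColorLieAlgebra χ V) (c : ColorCocycle L) :
    IsNoetherianRing (Uenv L c) ∧ IsNoetherianRing (Uenv L c)ᵐᵒᵖ := by
  obtain ⟨n, d, v, hv, hspan⟩ := L.exists_homogeneous_span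
  have hmap : ∀ w, Uι L c w ∈ Submodule.span K (Set.range fun i => Uι L c (v i)) := by
    intro w
    have hw : w ∈ Submodule.span K (Set.range v) := hspan ▸ Submodule.mem_top
    have h := Submodule.mem_map_of_mem (f := Uι L c) hw
    rwa [Submodule.map_span, ← Set.range_comp] at h
  have hgen : Algebra.adjoin K (Set.range fun i => Uι L c (v i)) = ⊤ := by
    rw [eq_top_iff, ← adjoin_range_Uι L c]
    refine Algebra.adjoin_le ?_
    rintro _ ⟨w, rfl⟩
    exact Algebra.span_le_adjoin K _ (hmap w)
  have hx : ∀ i j, ∃ q : K, q ≠ 0 ∧ Uι L c (v i) * Uι L c (v j) -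
      q • (Uι L c (v j) * Uι L c (v i)) ∈ wordSpan K (fun i => Uι L c (v i)) 2 := by
    intro i j
    refine ⟨χ.ε (d i) (d j), left_ne_zero_of_mul_eq_one (χ.antisym _ _), ?_⟩
    rw [Uι_mul L c (hv i) (hv j), add_assoc, add_sub_cancel_left, Algebra.algebraMap_eq_smul_one]
    refine add_mem (Submodule.span_le.2 ?_ (hmap _)) (Submodule.smul_mem _ _ ?_)
    · rintro _ ⟨k, rfl⟩
      exact Submodule.subset_span ⟨[k], by simp, by simp⟩
    · exact Submodule.subset_span ⟨[], by simp, by simp⟩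
  exact ⟨isNoetherianRing_of_quasiCommuting hgen hx,
    isNoetherianRing_op_of_quasiCommuting hgen hx⟩
end
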